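/- arXiv:2310.10828 — 9 statements merged into one kernel-verified Lean document; each statement's English description precedes it below -/
import Mathlib

section
/- Let A be a compact convex subset of ℝ^m, let X be a metric space, and let α > 0. Suppose F_n : X × A → ℝ are continuous, for every x ∈ X the map a ↦ F_n(x,a) is α-strongly convex, and F_n converges to F : X × A → ℝ uniformly on compact subsets of X × A. Then for each n and each x the function F_n(x,·) attains its minimum over A at a unique point f_n(x), the function F(x,·) attains its minimum over A at a unique point f(x), and f_n(x_n) → f(x) in ℝ^m whenever x_n → x in X. -/
open Filter Topology

/-- For `α > 0`, a function `h` is `α`-strongly convex on a convex set `A ⊆ ℝ^m`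
if `h − (α/2)‖·‖²` is convex on `A`. -/
def IsStrongConvexOn {m : ℕ} (A : Set (EuclideanSpace ℝ (Fin m))) (α : ℝ)
    (h : EuclideanSpace ℝ (Fin m) → ℝ) : Prop :=
  ConvexOn ℝ A (fun a => h a - α / 2 * ‖a‖ ^ 2)

/-- The midpoint inequality satisfied by `α`-strongly convex functions. -/
def MidpointStrongConvexOn {E : Type*} [NormedAddCommGroup E] [NormedSpace ℝ E]
    (A : Set E) (α : ℝ) (h : E → ℝ) : Prop :=
  ∀ a ∈ A, ∀ b ∈ A,
    h ((1 / 2 : ℝ) • a + (1 / 2 : ℝ) • b) ≤ (h a + h b) / 2 - α / 8 * ‖a - b‖ ^ 2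

theorem IsStrongConvexOn.midpointStrongConvexOn {m : ℕ} {A : Set (EuclideanSpace ℝ (Fin m))}
    {α : ℝ} {h : EuclideanSpace ℝ (Fin m) → ℝ} (hh : IsStrongConvexOn A α h) :
    MidpointStrongConvexOn A α h := by
  intro a ha b hb
  have key := hh.2 ha hb (by norm_num : (0 : ℝ) ≤ 1 / 2) (by norm_num : (0 : ℝ) ≤ 1 / 2)
    (by norm_num)
  have hnorm : ‖(1 / 2 : ℝ) • a + (1 / 2 : ℝ) • b‖ ^ 2 = 1 / 4 * ‖a + b‖ ^ 2 := by
    rw [← smul_add, norm_smul, mul_pow]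
    norm_num
  have hpar := parallelogram_law_with_norm ℝ a b
  simp only [hnorm, smul_eq_mul] at key
  linear_combination key + α / 8 * hpar

theorem MidpointStrongConvexOn.of_tendsto {E : Type*} [NormedAddCommGroup E] [NormedSpace ℝ E]
    {A : Set E} (hA : Convex ℝ A) {α : ℝ} {h : ℕ → E → ℝ} {g : E → ℝ}
    (hh : ∀ n, MidpointStrongConvexOn A α (h n))
    (hlim : ∀ a ∈ A, Tendsto (fun n => h n a) atTop (𝓝 (g a))) :
    MidpointStrongConvexOn A α g := by
  intro a ha b hb
  have hmid : (1 / 2 : ℝ) • a + (1 / 2 : ℝ) • b ∈ A :=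
    hA ha hb (by norm_num) (by norm_num) (by norm_num)
  exact le_of_tendsto_of_tendsto' (hlim _ hmid)
    ((((hlim a ha).add (hlim b hb)).div_const 2).sub_const _) fun n => hh n a ha b hb

/-- Quadratic growth of a strongly convex function away from a minimizer. -/
theorem MidpointStrongConvexOn.norm_sub_sq_le {E : Type*} [NormedAddCommGroup E]
    [NormedSpace ℝ E] {A : Set E} (hA : Convex ℝ A) {α : ℝ} {h : E → ℝ}
    (hh : MidpointStrongConvexOn A α h) {p : E} (hp : p ∈ A) (hmin : ∀ a ∈ A, h p ≤ h a)
    {a : E} (ha : a ∈ A) : α / 4 * ‖a - p‖ ^ 2 ≤ h a - h p := by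
  have hmid := hmin _ (hA ha hp (by norm_num : (0 : ℝ) ≤ 1 / 2)
    (by norm_num : (0 : ℝ) ≤ 1 / 2) (by norm_num))
  linarith [hh a ha p hp]

theorem MidpointStrongConvexOn.exists_unique_minimizer {E : Type*} [NormedAddCommGroup E]
    [NormedSpace ℝ E] {A : Set E} (hAcomp : IsCompact A) (hA : Convex ℝ A) (hAne : A.Nonempty)
    {α : ℝ} (hα : 0 < α) {h : E → ℝ} (hh : MidpointStrongConvexOn A α h)
    (hcont : ContinuousOn h A) :
    ∃ p, p ∈ A ∧ (∀ a ∈ A, h p ≤ h a) ∧ ∀ a ∈ A, (∀ b ∈ A, h a ≤ h b) → a = p := by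
  obtain ⟨p, hp, hmin⟩ := hAcomp.exists_isMinOn hAne hcont
  refine ⟨p, hp, fun a ha => hmin ha, fun a ha hamin => ?_⟩
  have hgrowth := hh.norm_sub_sq_le hA hp (fun a ha => hmin ha) ha
  have hle : α / 4 * ‖a - p‖ ^ 2 ≤ 0 := by linarith [hamin p hp]
  have hsq : ‖a - p‖ ^ 2 ≤ 0 := nonpos_of_mul_nonpos_right hle (by positivity)
  exact sub_eq_zero.mp (norm_eq_zero.mp (pow_eq_zero_iff two_ne_zero |>.mp
    (le_antisymm hsq (sq_nonneg _))))

/-- If `Fₙ : X × A → ℝ` are continuous, `α`-strongly convex in the second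
variable, and converge to `F` uniformly on compact subsets of `X × A`, then each `Fₙ(x,·)`
has a unique minimizer `fₙ(x)` on `A`, `F(x,·)` has a unique minimizer `f(x)` on `A`, and
`fₙ(xₙ) → f(x)` whenever `xₙ → x`. -/
theorem statement2 {m : ℕ} {X : Type*} [MetricSpace X]
    (A : Set (EuclideanSpace ℝ (Fin m))) (hAcomp : IsCompact A) (hAconv : Convex ℝ A)
    (hAne : A.Nonempty)
    (α : ℝ) (hα : 0 < α)
    (F : ℕ → X → EuclideanSpace ℝ (Fin m) → ℝ)
    (G : X → EuclideanSpace ℝ (Fin m) → ℝ)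
    (hFcont : ∀ n, ContinuousOn (fun q : X × EuclideanSpace ℝ (Fin m) => F n q.1 q.2)
      (Set.univ ×ˢ A))
    (hFconv : ∀ n x, IsStrongConvexOn A α (F n x))
    (hunif : ∀ K : Set (X × EuclideanSpace ℝ (Fin m)), K ⊆ Set.univ ×ˢ A → IsCompact K →
      TendstoUniformlyOn (fun n q => F n q.1 q.2) (fun q => G q.1 q.2) atTop K) :
    ∃ (fn : ℕ → X → EuclideanSpace ℝ (Fin m)) (f : X → EuclideanSpace ℝ (Fin m)),
      (∀ n x, fn n x ∈ A ∧ (∀ a ∈ A, F n x (fn n x) ≤ F n x a) ∧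
        (∀ a ∈ A, (∀ b ∈ A, F n x a ≤ F n x b) → a = fn n x)) ∧
      (∀ x, f x ∈ A ∧ (∀ a ∈ A, G x (f x) ≤ G x a) ∧
        (∀ a ∈ A, (∀ b ∈ A, G x a ≤ G x b) → a = f x)) ∧
      ∀ (x : X) (xs : ℕ → X), Tendsto xs atTop (𝓝 x) →
        Tendsto (fun n => fn n (xs n)) atTop (𝓝 (f x)) := by
  have hslice (x : X) : Set.MapsTo (fun a : EuclideanSpace ℝ (Fin m) => (x, a)) A
      (Set.univ ×ˢ A) := fun a ha => ⟨Set.mem_univ _, ha⟩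
  have hGcont : ∀ K : Set (X × EuclideanSpace ℝ (Fin m)), K ⊆ Set.univ ×ˢ A → IsCompact K →
      ContinuousOn (fun q : X × EuclideanSpace ℝ (Fin m) => G q.1 q.2) K := fun K hK hKc =>
    (hunif K hK hKc).continuousOn (Frequently.of_forall fun n => (hFcont n).mono hK)
  have hGmid (x : X) : MidpointStrongConvexOn A α (G x) :=
    MidpointStrongConvexOn.of_tendsto hAconv (fun n => (hFconv n x).midpointStrongConvexOn)
      fun a ha => (hunif {(x, a)} (Set.singleton_subset_iff.mpr (hslice x ha))
        isCompact_singleton).tendsto_at rfl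
  have hGx (x : X) : ContinuousOn (G x) A :=
    (hGcont ({x} ×ˢ A) (Set.prod_mono_left (Set.subset_univ _))
      (isCompact_singleton.prod hAcomp)).comp (f := fun a => (x, a))
      (by fun_prop) fun a ha => ⟨rfl, ha⟩
  have hFx (n : ℕ) (x : X) : ContinuousOn (F n x) A :=
    (hFcont n).comp (f := fun a => (x, a)) (by fun_prop) (hslice x)
  choose fn hfn using fun n x => (hFconv n x).midpointStrongConvexOn.exists_unique_minimizer
    hAcomp hAconv hAne hα (hFx n x)
  choose f hf using fun x => (hGmid x).exists_unique_minimizer hAcomp hAconv hAne hα (hGx x)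
  refine ⟨fn, f, hfn, hf, fun x xs hxs => ?_⟩
  set K : Set (X × EuclideanSpace ℝ (Fin m)) := insert x (Set.range xs) ×ˢ A
  have hKsub : K ⊆ Set.univ ×ˢ A := Set.prod_mono_left (Set.subset_univ _)
  have hKcomp : IsCompact K := hxs.isCompact_insert_range.prod hAcomp
  have hGuc := hKcomp.uniformContinuousOn_of_continuous (hGcont K hKsub hKcomp)
  rw [Metric.tendsto_nhds]
  intro ε hε
  have hη : 0 < α / 16 * ε ^ 2 := by positivity
  obtain ⟨δ, hδ, hGδ⟩ := Metric.uniformContinuousOn_iff.mp hGuc _ hη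
  filter_upwards [Metric.tendstoUniformlyOn_iff.mp (hunif K hKsub hKcomp) _ hη,
    Metric.tendsto_nhds.mp hxs δ hδ] with n hFG hxn
  have hmem {a} (ha : a ∈ A) : (x, a) ∈ K := ⟨Set.mem_insert _ _, ha⟩
  have hmem' {a} (ha : a ∈ A) : (xs n, a) ∈ K :=
    ⟨Set.mem_insert_of_mem _ (Set.mem_range_self n), ha⟩
  have hG_near {a} (ha : a ∈ A) : |G (xs n) a - G x a| < α / 16 * ε ^ 2 :=
    hGδ _ (hmem' ha) _ (hmem ha) (by simpa [Prod.dist_eq, hδ] using hxn)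
  have hF_near {a} (ha : a ∈ A) : |G (xs n) a - F n (xs n) a| < α / 16 * ε ^ 2 :=
    hFG _ (hmem' ha)
  obtain ⟨hq, hqmin, -⟩ := hfn n (xs n)
  obtain ⟨hp, hpmin, -⟩ := hf x
  have hgrowth := (hGmid x).norm_sub_sq_le hAconv hp hpmin hq
  have h₁ := abs_lt.mp (hG_near hq)
  have h₂ := abs_lt.mp (hF_near hq)
  have h₃ := abs_lt.mp (hG_near hp)
  have h₄ := abs_lt.mp (hF_near hp)
  have hlt : α / 4 * ‖fn n (xs n) - f x‖ ^ 2 < α / 4 * ε ^ 2 := by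
    linarith [hqmin _ hp]
  rw [dist_eq_norm]
  exact lt_of_pow_lt_pow_left₀ 2 hε.le (lt_of_mul_lt_mul_left hlt (by positivity))
end

section
/- Let X be a Polish space and A a compact metric space. Let F_n, F : X × A → ℝ be continuous with F_n → F uniformly on compact subsets of X × A. Set C_n = {(x,a) ∈ X × A : F_n(x,a) = min_{a'∈A} F_n(x,a')} and C = {(x,a) ∈ X × A : F(x,a) = min_{a'∈A} F(x,a')}. If λ_n are Borel probability measures on X × A with λ_n(C_n) = 1 for every n and λ_n converges weakly to a Borel probability measure λ, then λ(C) = 1. -/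
open Filter Topology MeasureTheory

/-- Uniform convergence on compact sets to a continuous limit implies continuous convergence. -/
theorem tendsto_prod_nhds_of_tendstoUniformlyOn_compact {Z : Type*} [TopologicalSpace Z]
    [FirstCountableTopology Z] {F : ℕ → Z → ℝ} {G : Z → ℝ} (hG : Continuous G)
    (h : ∀ K : Set Z, IsCompact K → TendstoUniformlyOn F G atTop K) (q : Z) :
    Tendsto (fun u : ℕ × Z => F u.1 u.2) (atTop ×ˢ 𝓝 q) (𝓝 (G q)) := by
  refine tendsto_of_seq_tendsto fun u hu => ?_
  have h1 : Tendsto (fun k => (u k).1) atTop atTop := tendsto_fst.comp hu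
  have h2 : Tendsto (fun k => (u k).2) atTop (𝓝 q) := tendsto_snd.comp hu
  have hK := Metric.tendstoUniformlyOn_iff.1 (h _ h2.isCompact_insert_range)
  rw [Metric.tendsto_nhds]
  intro ε hε
  filter_upwards [h1.eventually (hK (ε / 2) (half_pos hε)),
    Metric.tendsto_nhds.1 ((hG.tendsto q).comp h2) (ε / 2) (half_pos hε)] with k hk hk'
  have hk := hk (u k).2 (Set.mem_insert_of_mem _ ⟨k, rfl⟩)
  rw [dist_comm] at hk
  exact (dist_triangle _ _ _).trans_lt (by simpa using add_lt_add hk hk')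

theorem setOf_eq_iInf_eq_iInter {X A : Type*} [TopologicalSpace X] [TopologicalSpace A]
    [CompactSpace A] [Nonempty A] {F : X × A → ℝ} (hF : Continuous F) :
    {q : X × A | F q = ⨅ a' : A, F (q.1, a')} = ⋂ a' : A, {q | F q ≤ F (q.1, a')} := by
  ext q
  have hb : BddBelow (Set.range fun a' : A => F (q.1, a')) :=
    (isCompact_range (by fun_prop)).bddBelow
  simp only [Set.mem_ofPred_eq, Set.mem_iInter]
  exact ⟨fun h a' => h.trans_le (ciInf_le hb a'),
    fun h => le_antisymm (le_ciInf h) (ciInf_le hb q.2)⟩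

theorem isClosed_setOf_eq_iInf {X A : Type*} [TopologicalSpace X] [TopologicalSpace A]
    [CompactSpace A] [Nonempty A] {F : X × A → ℝ} (hF : Continuous F) :
    IsClosed {q : X × A | F q = ⨅ a' : A, F (q.1, a')} := by
  rw [setOf_eq_iInf_eq_iInter hF]
  exact isClosed_iInter fun a' => isClosed_le hF (by fun_prop)

/-- Let `X` be Polish and `A` compact metric, `Fₙ → F` uniformly on compact
subsets of `X × A`, `Cₙ` (resp. `C`) the set of pairs `(x,a)` at which `Fₙ(x,·)` (resp.
`F(x,·)`) attains its minimum over `A`. If `λₙ` are Borel probability measures on `X × A`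
with `λₙ(Cₙ) = 1` converging weakly to `λ`, then `λ(C) = 1`. -/
theorem statement3 {X A : Type*}
    [MetricSpace X] [PolishSpace X] [MeasurableSpace X] [BorelSpace X]
    [MetricSpace A] [CompactSpace A] [Nonempty A] [MeasurableSpace A] [BorelSpace A]
    (F : ℕ → X × A → ℝ) (G : X × A → ℝ)
    (hFcont : ∀ n, Continuous (F n)) (hGcont : Continuous G)
    (hunif : ∀ K : Set (X × A), IsCompact K → TendstoUniformlyOn F G atTop K)
    (lam : ℕ → Measure (X × A)) (lam0 : Measure (X × A))
    (hprob : ∀ n, IsProbabilityMeasure (lam n))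
    (hprob0 : IsProbabilityMeasure lam0)
    (hCn : ∀ n, lam n {q : X × A | F n q = ⨅ a' : A, F n (q.1, a')} = 1)
    (hweak : ∀ g : BoundedContinuousFunction (X × A) ℝ,
      Tendsto (fun n => ∫ q, g q ∂(lam n)) atTop (𝓝 (∫ q, g q ∂lam0))) :
    lam0 {q : X × A | G q = ⨅ a' : A, G (q.1, a')} = 1 := by
  rw [← prob_compl_eq_zero_iff (isClosed_setOf_eq_iInf hGcont).measurableSet]
  refine measure_null_of_locally_null _ fun q hq => ?_
  obtain ⟨a', ha'⟩ : ∃ a' : A, G (q.1, a') < G q := by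
    simpa [setOf_eq_iInf_eq_iInter hGcont] using hq
  have hlim := tendsto_prod_nhds_of_tendstoUniformlyOn_compact hGcont hunif
  have hproj : Tendsto (fun u : ℕ × (X × A) => (u.1, (u.2.1, a'))) (atTop ×ˢ 𝓝 q)
      (atTop ×ˢ 𝓝 (q.1, a')) :=
    tendsto_fst.prodMk
      (((by fun_prop : Continuous fun p : X × A => (p.1, a')).tendsto q).comp tendsto_snd)
  have hlt := ((hlim (q.1, a')).comp hproj).eventually_lt (hlim q) ha'
  obtain ⟨P, hP, Q, hQ, hPQ⟩ := eventually_prod_iff.1 hlt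
  obtain ⟨U, hUQ, hU, hqU⟩ := mem_nhds_iff.1 hQ
  refine ⟨U, mem_nhdsWithin_of_mem_nhds (hU.mem_nhds hqU), ?_⟩
  have hzero : ∀ᶠ n in atTop, lam n U = 0 := by
    filter_upwards [hP] with n hn
    refine measure_mono_null ?_
      ((prob_compl_eq_zero_iff (isClosed_setOf_eq_iInf (hFcont n)).measurableSet).2 (hCn n))
    intro p hp hpC
    rw [setOf_eq_iInf_eq_iInter (hFcont n)] at hpC
    exact (hPQ hn (hUQ hp)).not_ge (Set.mem_iInter.1 hpC a')
  let μ : ℕ → ProbabilityMeasure (X × A) := fun n => ⟨lam n, hprob n⟩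
  let μ₀ : ProbabilityMeasure (X × A) := ⟨lam0, hprob0⟩
  have hconv : Tendsto μ atTop (𝓝 μ₀) :=
    ProbabilityMeasure.tendsto_iff_forall_integral_tendsto.2 hweak
  have hle : lam0 U ≤ atTop.liminf fun n => lam n U :=
    ProbabilityMeasure.le_liminf_measure_open_of_tendsto hconv hU
  rw [liminf_congr hzero, liminf_const] at hle
  exact nonpos_iff_eq_zero.1 hle
end

section
/- Let X be a Polish space and A a compact metric space. Let F_n, F : X × A → ℝ be continuous with F_n → F uniformly on compact subsets of X × A, and suppose that for every x ∈ X the function a ↦ F(x,a) has a unique minimizer f(x) on A (the map f : X → A is then automatically continuous). Let ν_n → ν weakly in the space of Borel probability measures on X, and let π_n be Borel stochastic kernels from X to A such that for every x the support of π_n(·|x) is contained in the set of minimizers of a ↦ F_n(x,a) over A. Then the probability measures ν_n ⊗ π_n on X × A, defined by (ν_n ⊗ π_n)(dx,da) = π_n(da|x) ν_n(dx), converge weakly to ν ⊗ π, where π(·|x) = δ_{f(x)}(·). -/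
open Filter Topology MeasureTheory ProbabilityTheory

/-- The (topological) support of a Borel measure: the set of points all of whose open
neighbourhoods have nonzero measure. -/
def measureSupport {A : Type*} [TopologicalSpace A] [MeasurableSpace A]
    (μ : Measure A) : Set A :=
  {a | ∀ U : Set A, IsOpen U → a ∈ U → μ U ≠ 0}

lemma ae_mem_measureSupport {A : Type*} [TopologicalSpace A] [SecondCountableTopology A]
    [MeasurableSpace A] (μ : Measure A) : ∀ᵐ a ∂μ, a ∈ measureSupport μ := by
  refine measure_null_of_locally_null _ fun a ha => ?_
  have ha' : ¬ ∀ U : Set A, IsOpen U → a ∈ U → μ U ≠ 0 := ha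
  push Not at ha'
  obtain ⟨U, hU, haU, h0⟩ := ha'
  exact ⟨U, mem_nhdsWithin_of_mem_nhds (hU.mem_nhds haU), h0⟩

/-- The selection of the unique minimizer over a compact parameter space is continuous. -/
lemma continuous_of_unique_minimizer {X A : Type*} [TopologicalSpace X] [TopologicalSpace A]
    [CompactSpace A] {G : X × A → ℝ} (hG : Continuous G) {f : X → A}
    (hfmin : ∀ x a, G (x, f x) ≤ G (x, a))
    (hfuniq : ∀ x a, (∀ b, G (x, a) ≤ G (x, b)) → a = f x) : Continuous f := by
  refine continuous_iff_isClosed.2 fun C hC => ?_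
  have hgraph : IsClosed {q : X × A | ∀ b, G q ≤ G (q.1, b)} := by
    simp only [Set.ofPred_forall]
    exact isClosed_iInter fun b => isClosed_le hG (by fun_prop)
  convert isClosedMap_fst_of_compactSpace _ (hgraph.inter (hC.preimage continuous_snd)) using 1
  ext x
  constructor
  · exact fun hx => ⟨(x, f x), ⟨hfmin x, hx⟩, rfl⟩
  · rintro ⟨⟨y, a⟩, ⟨hmin, ha⟩, rfl⟩
    have := hfuniq y a hmin
    subst this
    exact ha

/-- A weakly convergent sequence of Borel probability measures on a Polish space is tight. -/
lemma exists_isCompact_measure_compl_le_of_tendsto {X : Type*} [TopologicalSpace X]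
    [PolishSpace X] [MeasurableSpace X] [BorelSpace X] {ν : ℕ → ProbabilityMeasure X}
    {ν0 : ProbabilityMeasure X} (h : Tendsto ν atTop (𝓝 ν0)) {ε : ENNReal} (hε : 0 < ε) :
    ∃ K : Set X, IsCompact K ∧ ∀ n, (ν n : Measure X) Kᶜ ≤ ε := by
  let _ := TopologicalSpace.upgradeIsCompletelyMetrizable X
  have hc := h.isCompact_insert_range
  obtain ⟨K, hK, hK'⟩ := isTightMeasureSet_iff_exists_isCompact_measure_compl_le.1
    (isTightMeasureSet_of_isCompact_closure (hc.closure)) ε hε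
  exact ⟨K, hK, fun n => hK' _ ⟨ν n, by simp, rfl⟩⟩

/-- Under uniform convergence on `K ×ˢ univ`, minimizers of `F n (x, ·)` eventually lie close,
uniformly in `x ∈ K`, to the unique minimizer of `G (x, ·)`, when closeness is tested through a
continuous function. -/
lemma eventually_dist_lt_of_minimizer {X A : Type*} [TopologicalSpace X] [T2Space X]
    [TopologicalSpace A] [CompactSpace A] {F : ℕ → X × A → ℝ} {G : X × A → ℝ}
    (hG : Continuous G) {f : X → A} (hf : Continuous f)
    (hfmin : ∀ x a, G (x, f x) ≤ G (x, a))
    (hfuniq : ∀ x a, (∀ b, G (x, a) ≤ G (x, b)) → a = f x) {K : Set X} (hK : IsCompact K)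
    (hunif : TendstoUniformlyOn F G atTop (K ×ˢ Set.univ))
    {g : X × A → ℝ} (hg : Continuous g) {ε : ℝ} (hε : 0 < ε) :
    ∀ᶠ n in atTop, ∀ x ∈ K, ∀ a, (∀ b, F n (x, a) ≤ F n (x, b)) →
      |g (x, a) - g (x, f x)| < ε := by
  set C : Set (X × A) := (K ×ˢ Set.univ) ∩ {q | ε ≤ |g q - g (q.1, f q.1)|} with hCdef
  have hC : IsCompact C :=
    (hK.prod isCompact_univ).inter_right (isClosed_le continuous_const (by fun_prop))
  have hpos : ∀ q ∈ C, 0 < G q - G (q.1, f q.1) := by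
    rintro ⟨x, a⟩ ⟨-, hq⟩
    refine sub_pos.2 (lt_of_le_of_ne (hfmin x a) fun heq => ?_)
    have : a = f x := hfuniq x a fun b => heq ▸ hfmin x b
    subst this
    simp at hq
    linarith
  obtain ⟨δ, hδ, hδC⟩ : ∃ δ > 0, ∀ q ∈ C, δ ≤ G q - G (q.1, f q.1) := by
    rcases C.eq_empty_or_nonempty with h | h
    · exact ⟨1, one_pos, by simp [h]⟩
    · obtain ⟨q, hq, hmin⟩ := hC.exists_isMinOn h
        (f := fun q => G q - G (q.1, f q.1)) (by fun_prop)
      exact ⟨_, hpos q hq, fun r hr => hmin hr⟩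
  filter_upwards [Metric.tendstoUniformlyOn_iff.1 hunif (δ / 2) (by positivity)] with n hn x hx a ha
  by_contra! hlt
  have h1 := hn (x, a) ⟨hx, trivial⟩
  have h2 := hn (x, f x) ⟨hx, trivial⟩
  have h3 := hδC (x, a) ⟨⟨hx, trivial⟩, hlt⟩
  have h4 := ha (f x)
  rw [Real.dist_eq, abs_lt] at h1 h2
  dsimp only at h3
  linarith

/-- If `|φ| ≤ M` everywhere and `|φ| ≤ ε` almost everywhere on `S`, then the integral of `φ` is at
most `ε + M μ(Sᶜ)` in absolute value. -/
lemma integral_abs_le_of_ae_le {Ω : Type*} [MeasurableSpace Ω] {μ : Measure Ω}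
    [IsProbabilityMeasure μ] {φ : Ω → ℝ} {S : Set Ω} (hS : MeasurableSet S) {ε M : ℝ}
    (hε : 0 ≤ ε) (hφM : ∀ ω, |φ ω| ≤ M) (hφ : ∀ᵐ ω ∂μ, ω ∈ S → |φ ω| ≤ ε) :
    |∫ ω, φ ω ∂μ| ≤ ε + M * μ.real Sᶜ := by
  calc |∫ ω, φ ω ∂μ| ≤ ∫ ω, |φ ω| ∂μ := abs_integral_le_integral_abs
    _ ≤ ∫ ω, (ε + Sᶜ.indicator (fun _ => M) ω) ∂μ := by
      refine integral_mono_of_nonneg (ae_of_all _ fun _ => abs_nonneg _)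
        ((integrable_const _).add ((integrable_const _).indicator hS.compl)) ?_
      filter_upwards [hφ] with ω hω
      by_cases h : ω ∈ S
      · simpa [h] using hω h
      · simpa [h] using (hφM ω).trans (le_add_of_nonneg_left hε)
    _ = ε + M * μ.real Sᶜ := by
      rw [integral_add (integrable_const _) ((integrable_const _).indicator hS.compl),
        integral_indicator_const _ hS.compl]
      simp [mul_comm]

/-- `X` Polish, `A` compact metric, `Fₙ → F` uniformly on compacts, `F(x,·)`
with unique minimizer `f(x)` for each `x`. If `νₙ → ν` weakly and `πₙ` are stochastic kernels
supported in the minimizers of `Fₙ(x,·)`, then `νₙ ⊗ πₙ → ν ⊗ δ_{f(·)}` weakly; moreover `f`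
is continuous. -/
theorem statement4 {X A : Type*}
    [MetricSpace X] [PolishSpace X] [MeasurableSpace X] [BorelSpace X]
    [MetricSpace A] [CompactSpace A] [Nonempty A] [MeasurableSpace A] [BorelSpace A]
    (F : ℕ → X × A → ℝ) (G : X × A → ℝ)
    (hFcont : ∀ n, Continuous (F n)) (hGcont : Continuous G)
    (hunif : ∀ K : Set (X × A), IsCompact K → TendstoUniformlyOn F G atTop K)
    (f : X → A)
    (hfmin : ∀ x a, G (x, f x) ≤ G (x, a))
    (hfuniq : ∀ x a, (∀ b, G (x, a) ≤ G (x, b)) → a = f x)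
    (ν : ℕ → Measure X) (ν0 : Measure X)
    (hν : ∀ n, IsProbabilityMeasure (ν n)) (hν0 : IsProbabilityMeasure ν0)
    (hνweak : ∀ g : BoundedContinuousFunction X ℝ,
      Tendsto (fun n => ∫ x, g x ∂(ν n)) atTop (𝓝 (∫ x, g x ∂ν0)))
    (π : ℕ → Kernel X A) (hπ : ∀ n, IsMarkovKernel (π n))
    (hsupp : ∀ n x, measureSupport (π n x) ⊆ {a | ∀ b, F n (x, a) ≤ F n (x, b)}) :
    Continuous f ∧
      ∀ g : BoundedContinuousFunction (X × A) ℝ,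
        Tendsto (fun n => ∫ q, g q ∂((ν n) ⊗ₘ (π n))) atTop
          (𝓝 (∫ q, g q ∂(ν0.map fun x => (x, f x)))) := by
  have hf := continuous_of_unique_minimizer hGcont hfmin hfuniq
  refine ⟨hf, fun g => ?_⟩
  have hgraph : Continuous fun x => (x, f x) := by fun_prop
  let h : BoundedContinuousFunction X ℝ := g.compContinuous ⟨fun x => (x, f x), hgraph⟩
  rw [integral_map hgraph.aemeasurable g.continuous.aestronglyMeasurable]
  have hlim : Tendsto (fun n => ∫ x, h x ∂(ν n)) atTop (𝓝 (∫ x, h x ∂ν0)) := hνweak h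
  have hgint (n : ℕ) : Integrable g (ν n ⊗ₘ π n) := g.integrable _
  have hhint (n : ℕ) : Integrable (fun q : X × A => h q.1) (ν n ⊗ₘ π n) :=
    (h.compContinuous ⟨Prod.fst, continuous_fst⟩).integrable _
  have hhfst (n : ℕ) : ∫ q, h q.1 ∂(ν n ⊗ₘ π n) = ∫ x, h x ∂(ν n) := by
    rw [Measure.integral_compProd (hhint n)]
    simp
  have hdiff : Tendsto (fun n => ∫ q, (g q - h q.1) ∂(ν n ⊗ₘ π n)) atTop (𝓝 0) := by
    refine Metric.tendsto_atTop'.2 fun ε hε => ?_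
    set M : ℝ := 2 * ‖g‖ + 1 with hMdef
    have hM : 0 < M := by positivity
    have hconv : Tendsto (β := ProbabilityMeasure X) (fun n => ⟨ν n, hν n⟩) atTop
        (𝓝 ⟨ν0, hν0⟩) :=
      ProbabilityMeasure.tendsto_iff_forall_integral_tendsto.2 hνweak
    obtain ⟨K, hK, hKν⟩ := exists_isCompact_measure_compl_le_of_tendsto hconv
      (ε := ENNReal.ofReal (ε / (4 * M))) (by simp; positivity)
    have hev := eventually_dist_lt_of_minimizer hGcont hf hfmin hfuniq hK
      (hunif _ (hK.prod isCompact_univ)) g.continuous (ε := ε / 4) (by positivity)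
    obtain ⟨N, hN⟩ := eventually_atTop.1 hev
    refine ⟨N, fun n hn => ?_⟩
    have hKm : MeasurableSet K := hK.measurableSet
    have hS : MeasurableSet (Prod.fst ⁻¹' K : Set (X × A)) := measurable_fst hKm
    have hcont : Continuous fun q : X × A => |g q - h q.1| := by fun_prop
    have hae : ∀ᵐ q ∂(ν n ⊗ₘ π n), q ∈ (Prod.fst ⁻¹' K : Set (X × A)) →
        |g q - h q.1| ≤ ε / 4 := by
      refine Measure.ae_compProd_of_ae_ae
        (hS.imp (measurableSet_le hcont.measurable measurable_const)) (ae_of_all _ fun x => ?_)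
      filter_upwards [ae_mem_measureSupport (π n x)] with a ha hx
      exact (hN n hn.le x hx a (hsupp n x ha)).le
    have hbound (q : X × A) : |g q - h q.1| ≤ M := by
      have h1 := g.norm_coe_le_norm q
      have h2 := g.norm_coe_le_norm (q.1, f q.1)
      have h3 := norm_sub_le (g q) (g (q.1, f q.1))
      change ‖g q - g (q.1, f q.1)‖ ≤ M
      linarith
    have hmeas : (ν n ⊗ₘ π n).real (Prod.fst ⁻¹' K : Set (X × A))ᶜ ≤ ε / (4 * M) := by
      refine ENNReal.toReal_le_of_le_ofReal (by positivity) ?_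
      rw [← Set.preimage_compl, ← Measure.fst_apply hKm.compl, Measure.fst_compProd]
      exact hKν n
    have hle := integral_abs_le_of_ae_le hS (by positivity) hbound hae
    have hmul : M * (ε / (4 * M)) = ε / 4 := by field_simp
    rw [dist_zero_right, Real.norm_eq_abs]
    nlinarith [mul_le_mul_of_nonneg_left hmeas hM.le]
  have hsum := hdiff.add hlim
  rw [zero_add] at hsum
  refine hsum.congr fun n => ?_
  rw [integral_sub (hgint n) (hhint n), hhfst n, sub_add_cancel]
end

section
/- Let X be a Polish space, A a compact metric space, p a Markov kernel from X × A to X, c : X × A → [0,∞) measurable, w : X × A → [1,∞) continuous, β ∈ (0,1), and M, α > 0 with αβ < 1. Assume c(x,a) ≤ M·w(x,a) and ∫_X w_max(y) p(dy|x,a) ≤ α·w(x,a) for all (x,a). For a measurable Q : X × A → ℝ whose pointwise infimum Q_min(x) = inf_{a∈A} Q(x,a) is measurable, define TQ(x,a) = c(x,a) + β ∫_X Q_min(y) p(dy|x,a). Then: (i) if Q ≥ 0 and ‖Q‖_w ≤ M/(1−αβ), then TQ ≥ 0 and ‖TQ‖_w ≤ M/(1−αβ); (ii) for any two measurable Q,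 Q̃ with measurable pointwise infima and finite w-norms, ‖TQ − TQ̃‖_w ≤ αβ · ‖Q − Q̃‖_w. -/
open Filter Topology MeasureTheory ProbabilityTheory

theorem abs_iInf_sub_iInf_le {ι : Type*} [Nonempty ι] {f g : ι → ℝ} {K : ℝ}
    (hf : BddBelow (Set.range f)) (hg : BddBelow (Set.range g))
    (h : ∀ i, |f i - g i| ≤ K) : |(⨅ i, f i) - ⨅ i, g i| ≤ K := by
  rw [abs_sub_le_iff]
  constructor
  · have : (⨅ i, f i) - K ≤ ⨅ i, g i := le_ciInf fun i => by
      linarith [ciInf_le hf i, (abs_sub_le_iff.1 (h i)).1]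
    linarith
  · have : (⨅ i, g i) - K ≤ ⨅ i, f i := le_ciInf fun i => by
      linarith [ciInf_le hg i, (abs_sub_le_iff.1 (h i)).2]
    linarith

/-- Two functions whose distance is at most `D` times a weight have pointwise infima whose
distance is at most `D` times the supremum of the weight. -/
theorem abs_iInf_sub_iInf_le_mul_iSup {ι : Type*} [Nonempty ι] {f g w : ι → ℝ} {D : ℝ}
    (hf : BddBelow (Set.range f)) (hg : BddBelow (Set.range g))
    (hw : BddAbove (Set.range w)) (hD : 0 ≤ D) (h : ∀ i, |f i - g i| ≤ D * w i) :
    |(⨅ i, f i) - ⨅ i, g i| ≤ D * ⨆ i, w i :=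
  abs_iInf_sub_iInf_le hf hg fun i =>
    (h i).trans (mul_le_mul_of_nonneg_left (le_ciSup hw i) hD)

theorem bddBelow_range_of_abs_le_mul {ι : Type*} {f w : ι → ℝ} {C : ℝ}
    (hw : BddAbove (Set.range w)) (hC : 0 ≤ C) (h : ∀ i, |f i| ≤ C * w i) :
    BddBelow (Set.range f) := by
  refine ⟨-(C * ⨆ i, w i), ?_⟩
  rintro _ ⟨i, rfl⟩
  exact (abs_le.1 ((h i).trans (mul_le_mul_of_nonneg_left (le_ciSup hw i) hC))).1

theorem abs_iInf_le_mul_iSup {ι : Type*} [Nonempty ι] {f w : ι → ℝ} {C : ℝ}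
    (hw : BddAbove (Set.range w)) (hC : 0 ≤ C) (h : ∀ i, |f i| ≤ C * w i) :
    |⨅ i, f i| ≤ C * ⨆ i, w i := by
  have h0 : BddBelow (Set.range fun _ : ι => (0 : ℝ)) := ⟨0, by rintro _ ⟨i, rfl⟩; exact le_rfl⟩
  simpa using abs_iInf_sub_iInf_le_mul_iSup (g := fun _ => 0)
    (bddBelow_range_of_abs_le_mul hw hC h) h0 hw hC (by simpa using h)

theorem abs_integral_le_mul_integral {Ω : Type*} [MeasurableSpace Ω] {μ : Measure Ω}
    {f g : Ω → ℝ} {D : ℝ} (hg : Integrable g μ) (h : ∀ y, |f y| ≤ D * g y) :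
    |∫ y, f y ∂μ| ≤ D * ∫ y, g y ∂μ := by
  rw [← integral_const_mul, ← Real.norm_eq_abs]
  exact norm_integral_le_of_norm_le (hg.const_mul D) (Eventually.of_forall h)

/-- Bellman-type operator `TQ(x,a) = c(x,a) + β ∫ Q_min(y) p(dy|x,a)` with
`c ≤ M·w`, `∫ w_max dp(·|x,a) ≤ α·w(x,a)` and `αβ < 1`.
(i) If `Q ≥ 0` and `‖Q‖_w ≤ M/(1−αβ)` then `TQ ≥ 0` and `‖TQ‖_w ≤ M/(1−αβ)`.
(ii) `‖TQ − TQ̃‖_w ≤ αβ·‖Q − Q̃‖_w` for measurable `Q, Q̃` with measurable pointwise infima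
and finite `w`-norms.  (Here `‖v‖_w ≤ D` is rendered pointwise as `|v(x,a)| ≤ D·w(x,a)`,
which is equivalent since `w ≥ 1 > 0`.) -/
theorem statement5 {X A : Type*}
    [MetricSpace X] [PolishSpace X] [MeasurableSpace X] [BorelSpace X]
    [MetricSpace A] [CompactSpace A] [Nonempty A] [MeasurableSpace A] [BorelSpace A]
    (p : Kernel (X × A) X) [IsMarkovKernel p]
    (c : X × A → ℝ) (hcmeas : Measurable c) (hc0 : ∀ q, 0 ≤ c q)
    (w : X × A → ℝ) (hwcont : Continuous w) (hw1 : ∀ q, 1 ≤ w q)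
    (β : ℝ) (hβ : β ∈ Set.Ioo (0 : ℝ) 1)
    (M α : ℝ) (hM : 0 < M) (hα : 0 < α) (hαβ : α * β < 1)
    (hcw : ∀ q, c q ≤ M * w q)
    (hwint : ∀ q, Integrable (fun y => ⨆ a : A, w (y, a)) (p q))
    (hwbd : ∀ q, (∫ y, (⨆ a : A, w (y, a)) ∂(p q)) ≤ α * w q) :
    -- (i)
    (∀ Q : X × A → ℝ, Measurable Q → Measurable (fun x => ⨅ a : A, Q (x, a)) →
      (∀ q, 0 ≤ Q q) → (∀ q, |Q q| ≤ M / (1 - α * β) * w q) →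
      ∀ q, 0 ≤ c q + β * ∫ y, (⨅ a : A, Q (y, a)) ∂(p q) ∧
        |c q + β * ∫ y, (⨅ a : A, Q (y, a)) ∂(p q)| ≤ M / (1 - α * β) * w q) ∧
    -- (ii)
    (∀ Q Q' : X × A → ℝ, Measurable Q → Measurable Q' →
      Measurable (fun x => ⨅ a : A, Q (x, a)) → Measurable (fun x => ⨅ a : A, Q' (x, a)) →
      (∃ C, ∀ q, |Q q| ≤ C * w q) → (∃ C, ∀ q, |Q' q| ≤ C * w q) →
      ∀ D : ℝ, (∀ q, |Q q - Q' q| ≤ D * w q) →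
        ∀ q, |(c q + β * ∫ y, (⨅ a : A, Q (y, a)) ∂(p q)) -
              (c q + β * ∫ y, (⨅ a : A, Q' (y, a)) ∂(p q))| ≤ α * β * D * w q) := by
  have hbdd : ∀ y, BddAbove (Set.range fun a => w (y, a)) := fun y =>
    (isCompact_range (by fun_prop : Continuous fun a => w (y, a))).bddAbove
  have hnonneg : ∀ {C : ℝ} (v : X × A → ℝ) (q : X × A), |v q| ≤ C * w q → 0 ≤ C :=
    fun v q h => nonneg_of_mul_nonneg_left ((abs_nonneg (v q)).trans h) (by linarith [hw1 q])
  obtain ⟨hβ0, -⟩ := hβ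
  have hpos : 0 < 1 - α * β := by linarith
  refine ⟨fun Q _ _ hQ0 hQ q => ?_, fun Q Q' _ _ hm hm' hC hC' D hD q => ?_⟩
  · set K := M / (1 - α * β) with hK
    have hK0 : 0 ≤ K := by positivity
    have hKM : M + α * β * K = K := by
      rw [hK]; field_simp; ring
    have hint0 : 0 ≤ ∫ y, (⨅ a : A, Q (y, a)) ∂(p q) :=
      integral_nonneg fun y => Real.iInf_nonneg fun a => hQ0 (y, a)
    have hint : |∫ y, (⨅ a : A, Q (y, a)) ∂(p q)| ≤ K * ∫ y, (⨆ a : A, w (y, a)) ∂(p q) :=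
      abs_integral_le_mul_integral (hwint q) fun y =>
        abs_iInf_le_mul_iSup (hbdd y) hK0 fun a => hQ (y, a)
    have hT0 : 0 ≤ c q + β * ∫ y, (⨅ a : A, Q (y, a)) ∂(p q) :=
      add_nonneg (hc0 q) (mul_nonneg hβ0.le hint0)
    refine ⟨hT0, ?_⟩
    rw [abs_of_nonneg hT0]
    calc c q + β * ∫ y, (⨅ a : A, Q (y, a)) ∂(p q)
        ≤ M * w q + β * (K * (α * w q)) := by
          gcongr
          · exact hcw q
          · exact ((le_abs_self _).trans hint).trans (mul_le_mul_of_nonneg_left (hwbd q) hK0)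
      _ = (M + α * β * K) * w q := by ring
      _ = K * w q := by rw [hKM]
  · obtain ⟨C, hC⟩ := hC
    obtain ⟨C', hC'⟩ := hC'
    have hC0 := hnonneg _ q (hC q)
    have hC0' := hnonneg _ q (hC' q)
    have hD0 := hnonneg (fun q => Q q - Q' q) q (hD q)
    have hi : Integrable (fun y => ⨅ a : A, Q (y, a)) (p q) :=
      ((hwint q).const_mul C).mono' hm.aestronglyMeasurable <| Eventually.of_forall fun y =>
        abs_iInf_le_mul_iSup (hbdd y) hC0 fun a => hC (y, a)
    have hi' : Integrable (fun y => ⨅ a : A, Q' (y, a)) (p q) :=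
      ((hwint q).const_mul C').mono' hm'.aestronglyMeasurable <| Eventually.of_forall fun y =>
        abs_iInf_le_mul_iSup (hbdd y) hC0' fun a => hC' (y, a)
    have hint := abs_integral_le_mul_integral (hwint q) fun y =>
      abs_iInf_sub_iInf_le_mul_iSup
        (bddBelow_range_of_abs_le_mul (hbdd y) hC0 fun a => hC (y, a))
        (bddBelow_range_of_abs_le_mul (hbdd y) hC0' fun a => hC' (y, a))
        (hbdd y) hD0 fun a => hD (y, a)
    rw [integral_sub hi hi'] at hint
    rw [add_sub_add_left_eq_sub, ← mul_sub, abs_mul, abs_of_pos hβ0]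
    calc _ ≤ β * (D * (α * w q)) := by
          gcongr
          exact hint.trans (mul_le_mul_of_nonneg_left (hwbd q) hD0)
      _ = α * β * D * w q := by ring
end

section
/- Let (E₁,d₁) and (E₂,d₂) be nonempty complete metric spaces, and let T₁ : E₁ × E₂ → E₁ and T₂ : E₁ × E₂ → E₂ satisfy, for all (x,y), (x',y') ∈ E₁ × E₂: d₁(T₁(x,y), T₁(x',y')) ≤ a·d₁(x,x') + B·d₂(y,y') and d₂(T₂(x,y), T₂(x',y')) ≤ C·d₁(x,x') + e·d₂(y,y'), where a, e ∈ [0,1), B > 0, C ≥ 0, and B·C < (1−a)·(1−e). Then the map T = (T₁,T₂) : E₁ × E₂ → E₁ × E₂ has a unique fixed point, and for every starting point (x₀,y₀) the iterates Tⁿ(x₀,y₀) converge to this fixed point. -/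
open Filter Topology

/-- **Banach fixed point theorem** for a map contracting a function `ρ` that is comparable with
the metric. -/
theorem exists_isFixedPt_of_contracting_comparable {X : Type*} [MetricSpace X] [CompleteSpace X]
    [Nonempty X] {f : X → X} {ρ : X → X → ℝ} {q M L : ℝ} (hq0 : 0 ≤ q) (hq1 : q < 1)
    (hM : 0 ≤ M) (hdist : ∀ x y, dist x y ≤ M * ρ x y) (hρ : ∀ x y, ρ x y ≤ L * dist x y)
    (hf : ∀ x y, ρ (f x) (f y) ≤ q * ρ x y) :
    ∃ z, f z = z ∧ (∀ z', f z' = z' → z' = z) ∧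
      ∀ x, Tendsto (fun n => f^[n] x) atTop (𝓝 z) := by
  have hiter : ∀ x y n, dist (f^[n] x) (f^[n] y) ≤ M * ρ x y * q ^ n := by
    intro x y n
    have h : ρ (f^[n] x) (f^[n] y) ≤ q ^ n * ρ x y := by
      induction n with
      | zero => simp
      | succ n ih =>
        rw [Function.iterate_succ_apply', Function.iterate_succ_apply', pow_succ', mul_assoc]
        exact (hf _ _).trans (mul_le_mul_of_nonneg_left ih hq0)
    calc dist (f^[n] x) (f^[n] y) ≤ M * ρ (f^[n] x) (f^[n] y) := hdist _ _
      _ ≤ M * (q ^ n * ρ x y) := mul_le_mul_of_nonneg_left h hM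
      _ = M * ρ x y * q ^ n := by ring
  have hcont : Continuous f := by
    refine (LipschitzWith.of_dist_le' (K := M * (q * L)) fun x y => ?_).continuous
    calc dist (f x) (f y) ≤ M * ρ (f x) (f y) := hdist _ _
      _ ≤ M * (q * (L * dist x y)) := mul_le_mul_of_nonneg_left
        ((hf x y).trans (mul_le_mul_of_nonneg_left (hρ x y) hq0)) hM
      _ = M * (q * L) * dist x y := by ring
  obtain ⟨x₀⟩ := ‹Nonempty X›
  obtain ⟨z, hz⟩ := cauchySeq_tendsto_of_complete <|
    cauchySeq_of_le_geometric (f := fun n => f^[n] x₀) q (M * ρ x₀ (f x₀)) hq1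
      fun n => hiter x₀ (f x₀) n
  have hfix : f z = z := isFixedPt_of_tendsto_iterate hz hcont.continuousAt
  have htendsto : ∀ x, Tendsto (fun n => f^[n] x) atTop (𝓝 z) := by
    intro x
    have h0 : Tendsto (fun n => M * ρ x z * q ^ n) atTop (𝓝 0) := by
      simpa using (tendsto_pow_atTop_nhds_zero_of_lt_one hq0 hq1).const_mul (M * ρ x z)
    refine tendsto_iff_dist_tendsto_zero.2 (squeeze_zero (fun _ => dist_nonneg) (fun n => ?_) h0)
    simpa only [Function.iterate_fixed hfix] using hiter x z n
  refine ⟨z, hfix, fun z' hz' => ?_, htendsto⟩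
  have h := htendsto z'
  simp only [Function.iterate_fixed hz'] at h
  exact tendsto_nhds_unique tendsto_const_nhds h

/-- Abstract fixed-point principle on a product of complete metric spaces:
if `d₁(T₁ z, T₁ z') ≤ a·d₁ + B·d₂` and `d₂(T₂ z, T₂ z') ≤ C·d₁ + e·d₂` with `a, e ∈ [0,1)`,
`B > 0`, `C ≥ 0` and `B·C < (1−a)(1−e)`, then `T = (T₁, T₂)` has a unique fixed point and
all orbits of `T` converge to it. -/
theorem statement6 {E₁ E₂ : Type*}
    [MetricSpace E₁] [CompleteSpace E₁] [Nonempty E₁]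
    [MetricSpace E₂] [CompleteSpace E₂] [Nonempty E₂]
    (T₁ : E₁ × E₂ → E₁) (T₂ : E₁ × E₂ → E₂)
    (a B C e : ℝ) (ha0 : 0 ≤ a) (ha1 : a < 1) (he0 : 0 ≤ e) (he1 : e < 1)
    (hB : 0 < B) (hC : 0 ≤ C) (hBC : B * C < (1 - a) * (1 - e))
    (hT₁ : ∀ z z' : E₁ × E₂, dist (T₁ z) (T₁ z') ≤ a * dist z.1 z'.1 + B * dist z.2 z'.2)
    (hT₂ : ∀ z z' : E₁ × E₂, dist (T₂ z) (T₂ z') ≤ C * dist z.1 z'.1 + e * dist z.2 z'.2) :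
    ∃ z : E₁ × E₂, (T₁ z, T₂ z) = z ∧
      (∀ z' : E₁ × E₂, (T₁ z', T₂ z') = z' → z' = z) ∧
      ∀ z₀ : E₁ × E₂,
        Tendsto (fun n => (fun w : E₁ × E₂ => (T₁ w, T₂ w))^[n] z₀) atTop (𝓝 z) := by
  have hgap : C / (1 - a) < (1 - e) / B := by
    rw [div_lt_div_iff₀ (by linarith) hB]
    linarith
  obtain ⟨l, hl₁, hl₂⟩ := exists_between hgap
  have hl : 0 < l := (div_nonneg hC (by linarith)).trans_lt hl₁
  rw [div_lt_iff₀ (by linarith)] at hl₁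
  rw [lt_div_iff₀ hB] at hl₂
  have hq₁ : a + C / l < 1 := by
    have : C / l < 1 - a := by
      rw [div_lt_iff₀ hl]
      linarith
    linarith
  refine exists_isFixedPt_of_contracting_comparable (f := fun w : E₁ × E₂ => (T₁ w, T₂ w))
    (ρ := fun z z' => l * dist z.1 z'.1 + dist z.2 z'.2)
    (q := max (a + C / l) (l * B + e)) (M := 1 / l + 1) (L := l + 1)
    (le_max_of_le_right (by positivity)) (max_lt hq₁ (by linarith)) (by positivity) ?_ ?_ ?_
  · intro x y
    have h : (1 / l + 1) * (l * dist x.1 y.1 + dist x.2 y.2) =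
        dist x.1 y.1 + dist x.2 y.2 + l * dist x.1 y.1 + dist x.2 y.2 / l := by
      field_simp
      ring
    have h₁ : 0 ≤ l * dist x.1 y.1 := by positivity
    have h₂ : 0 ≤ dist x.2 y.2 / l := by positivity
    rw [h, Prod.dist_eq]
    refine max_le ?_ ?_ <;> linarith [dist_nonneg (x := x.1) (y := y.1),
      dist_nonneg (x := x.2) (y := y.2)]
  · intro x y
    have h₁ : dist x.1 y.1 ≤ dist x y := le_max_left _ _
    have h₂ : dist x.2 y.2 ≤ dist x y := le_max_right _ _
    linarith [mul_le_mul_of_nonneg_left h₁ hl.le]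
  · intro x y
    calc l * dist (T₁ x) (T₁ y) + dist (T₂ x) (T₂ y)
        ≤ l * (a * dist x.1 y.1 + B * dist x.2 y.2) + (C * dist x.1 y.1 + e * dist x.2 y.2) :=
          add_le_add (mul_le_mul_of_nonneg_left (hT₁ x y) hl.le) (hT₂ x y)
      _ = (a + C / l) * (l * dist x.1 y.1) + (l * B + e) * dist x.2 y.2 := by
          field_simp
          ring
      _ ≤ max (a + C / l) (l * B + e) * (l * dist x.1 y.1) +
            max (a + C / l) (l * B + e) * dist x.2 y.2 := by
          gcongr
          · exact le_max_left _ _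
          · exact le_max_right _ _
      _ = max (a + C / l) (l * B + e) * (l * dist x.1 y.1 + dist x.2 y.2) := by ring
end

section
/- Let X be a locally compact Polish space, A a compact metric space, β ∈ (0,1), c : X × A → [0,∞) continuous, and w_max : X → [1,∞) continuous. Let p_n and p be Markov kernels from X × A to X such that p_n(·|x_n,a_n) → p(·|x,a) weakly and ∫_X w_max(y) p_n(dy|x_n,a_n) → ∫_X w_max(y) p(dy|x,a) whenever (x_n,a_n) → (x,a) in X × A. Let q_n, q : X → ℝ be functions such that q_n → q continuously and sup_n sup_x |q_n(x)|/w_max(x) < ∞ and sup_x |q(x)|/w_max(x) < ∞. Define G_n(x,a) = c(x,a) + β ∫_X q_n(y) p_n(dy|x,a) and G(x,a) = c(x,a) + β ∫_X q(y) p(dy|x,a). Then G_n → G continuously on X × A; in particular sup_{a∈A} |G_n(x_n,a) − G(x,a)| → 0 and min_{a∈A} G_n(x_n,a) → min_{a∈A} G(x,a) whenever x_n → x in X. -/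
open Filter Topology MeasureTheory ProbabilityTheory

section ContinuousConvergence

variable {E Y : Type*} [TopologicalSpace E] [FirstCountableTopology E]

/-- Sequential continuous convergence is convergence along the product filter
`atTop ×ˢ 𝓝 x`. -/
theorem tendsto_atTop_prod_nhds_of_seq [TopologicalSpace Y] {F : ℕ → E → Y} {f : E → Y}
    (h : ∀ (xs : ℕ → E) (x : E), Tendsto xs atTop (𝓝 x) →
      Tendsto (fun n => F n (xs n)) atTop (𝓝 (f x))) (x : E) :
    Tendsto (fun y : ℕ × E => F y.1 y.2) (atTop ×ˢ 𝓝 x) (𝓝 (f x)) := by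
  refine tendsto_of_subseq_tendsto fun ns hns => ?_
  have h1 : Tendsto (fun k => (ns k).1) atTop atTop := tendsto_fst.comp hns
  have h2 : Tendsto (fun k => (ns k).2) atTop (𝓝 x) := tendsto_snd.comp hns
  obtain ⟨φ, hφ, hmono⟩ := strictMono_subseq_of_tendsto_atTop h1
  refine ⟨φ, ?_⟩
  let m : ℕ → ℕ := fun k => (ns (φ k)).1
  have hmono' : StrictMono m := hmono
  let xs : ℕ → E := Function.extend m (fun k => (ns (φ k)).2) fun _ => x
  have hxs : Tendsto xs atTop (𝓝 x) := by
    refine tendsto_def.2 fun U hU => ?_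
    obtain ⟨K, hK⟩ := eventually_atTop.1 ((h2.comp hφ.tendsto_atTop).eventually hU)
    refine mem_atTop_sets.2 ⟨m K, fun j hj => ?_⟩
    by_cases hjm : ∃ k, m k = j
    · obtain ⟨k, rfl⟩ := hjm
      have : xs (m k) = (ns (φ k)).2 := hmono'.injective.extend_apply _ _ _
      rw [Set.mem_preimage, this]
      exact hK k (hmono'.le_iff_le.1 hj)
    · have : xs j = x := Function.extend_apply' _ _ _ hjm
      rw [Set.mem_preimage, this]
      exact mem_of_mem_nhds hU
  refine ((h xs x hxs).comp hmono'.tendsto_atTop).congr fun k => ?_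
  have : xs (m k) = (ns (φ k)).2 := hmono'.injective.extend_apply _ _ _
  exact congrArg (F (m k)) this

theorem continuous_of_seq_continuous_convergence [TopologicalSpace Y] [RegularSpace Y]
    {F : ℕ → E → Y} {f : E → Y}
    (h : ∀ (xs : ℕ → E) (x : E), Tendsto xs atTop (𝓝 x) →
      Tendsto (fun n => F n (xs n)) atTop (𝓝 (f x))) : Continuous f := by
  refine continuous_iff_continuousAt.2 fun x => ?_
  refine (closed_nhds_basis (f x)).tendsto_right_iff.2 fun V hV => ?_
  have hev := (tendsto_atTop_prod_nhds_of_seq h x).eventually hV.1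
  obtain ⟨P, hP, Q, hQ, hPQ⟩ := eventually_prod_iff.1 hev
  filter_upwards [hQ] with y hy
  exact hV.2.mem_of_tendsto (h (fun _ => y) y tendsto_const_nhds)
    (hP.mono fun n hn => hPQ hn hy)

theorem tendstoLocallyUniformly_of_seq_continuous_convergence [UniformSpace Y]
    {F : ℕ → E → Y} {f : E → Y}
    (h : ∀ (xs : ℕ → E) (x : E), Tendsto xs atTop (𝓝 x) →
      Tendsto (fun n => F n (xs n)) atTop (𝓝 (f x))) : TendstoLocallyUniformly F f atTop := by
  refine tendstoLocallyUniformly_iff_forall_tendsto.2 fun x => ?_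
  have hf : Tendsto (fun y : ℕ × E => f y.2) (atTop ×ˢ 𝓝 x) (𝓝 (f x)) :=
    ((continuous_of_seq_continuous_convergence h).tendsto x).comp tendsto_snd
  exact ((hf.prodMk_nhds (tendsto_atTop_prod_nhds_of_seq h x))).mono_right
    (nhds_le_uniformity _)

end ContinuousConvergence

section UniformLimits

variable {ι α : Type*} {l : Filter ι} {F : ι → α → ℝ} {f : α → ℝ}

theorem TendstoUniformly.tendsto_iSup_abs_sub (h : TendstoUniformly F f l) :
    Tendsto (fun n => ⨆ a, |F n a - f a|) l (𝓝 0) := by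
  refine Metric.tendsto_nhds.2 fun ε hε => ?_
  filter_upwards [Metric.tendstoUniformly_iff.1 h (ε / 2) (half_pos hε)] with n hn
  have h0 : 0 ≤ ⨆ a, |F n a - f a| := Real.iSup_nonneg fun a => abs_nonneg _
  have h1 : ⨆ a, |F n a - f a| ≤ ε / 2 := Real.iSup_le (fun a => by
    have := hn a
    rw [dist_comm, Real.dist_eq] at this
    exact this.le) (half_pos hε).le
  rw [Real.dist_eq, sub_zero, abs_of_nonneg h0]
  linarith

theorem TendstoUniformly.tendsto_iInf [Nonempty α] (h : TendstoUniformly F f l)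
    (hf : BddBelow (Set.range f)) :
    Tendsto (fun n => ⨅ a, F n a) l (𝓝 (⨅ a, f a)) := by
  refine Metric.tendsto_nhds.2 fun ε hε => ?_
  filter_upwards [Metric.tendstoUniformly_iff.1 h (ε / 2) (half_pos hε)] with n hn
  have hn' : ∀ a, |f a - F n a| < ε / 2 := hn
  have hF : BddBelow (Set.range (F n)) := by
    obtain ⟨b, hb⟩ := hf
    refine ⟨b - ε / 2, ?_⟩
    rintro _ ⟨a, rfl⟩
    have h1 : b ≤ f a := hb ⟨a, rfl⟩
    linarith [(abs_lt.1 (hn' a)).2]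
  have h1 : (⨅ a, f a) - ε / 2 ≤ ⨅ a, F n a := le_ciInf fun a => by
    linarith [ciInf_le hf a, (abs_lt.1 (hn' a)).2]
  have h2 : (⨅ a, F n a) - ε / 2 ≤ ⨅ a, f a := le_ciInf fun a => by
    linarith [ciInf_le hF a, (abs_lt.1 (hn' a)).1]
  rw [Real.dist_eq, abs_lt]
  constructor <;> linarith

end UniformLimits

section WeightedWeakConvergence

variable {X : Type*} [TopologicalSpace X] [MeasurableSpace X]

theorem tendsto_integral_of_hasCompactSupport {ι : Type*} {l : Filter ι} {ν : ι → Measure X}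
    {μ : Measure X}
    (hweak : ∀ g : BoundedContinuousFunction X ℝ,
      Tendsto (fun n => ∫ y, g y ∂(ν n)) l (𝓝 (∫ y, g y ∂μ)))
    {g : X → ℝ} (hg : Continuous g) (hgc : HasCompactSupport g) :
    Tendsto (fun n => ∫ y, g y ∂(ν n)) l (𝓝 (∫ y, g y ∂μ)) := by
  obtain ⟨B, hB⟩ := hgc.exists_bound_of_continuous hg
  exact hweak (BoundedContinuousFunction.ofNormedAddCommGroup g hg B hB)

variable [BorelSpace X]

/-- An integrable weight has small mass off a compactly supported cutoff function. -/
theorem exists_hasCompactSupport_integral_one_sub_mul_lt [R1Space X] [LocallyCompactSpace X]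
    [SigmaCompactSpace X] {μ : Measure X} {w : X → ℝ} (hw : Integrable w μ) {δ : ℝ} (hδ : 0 < δ) :
    ∃ φ : C(X, ℝ), HasCompactSupport φ ∧ (∀ x, φ x ∈ Set.Icc (0 : ℝ) 1) ∧
      ∫ y, (1 - φ y) * w y ∂μ < δ := by
  have hex : ∀ k : ℕ, ∃ f : C(X, ℝ), Set.EqOn f 1 (compactCovering X k) ∧
      IsCompact (tsupport f) ∧ tsupport f ⊆ Set.univ ∧ ∀ x, f x ∈ Set.Icc (0 : ℝ) 1 := fun k =>
    exists_continuousMap_one_of_isCompact_subset_isOpen (isCompact_compactCovering X k)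
      isOpen_univ (Set.subset_univ _)
  choose φ hφ1 hφc _ hφI using hex
  have hlim : Tendsto (fun k => ∫ y, (1 - φ k y) * w y ∂μ) atTop (𝓝 (∫ _, (0 : ℝ) ∂μ)) := by
    refine tendsto_integral_of_dominated_convergence (fun y => ‖w y‖) (fun k => ?_) hw.norm
      (fun k => ?_) ?_
    · exact (continuous_const.sub (φ k).continuous).measurable.aestronglyMeasurable.mul
        hw.aestronglyMeasurable
    · refine ae_of_all _ fun y => ?_
      rw [norm_mul]
      refine mul_le_of_le_one_left (norm_nonneg _) ?_
      rw [Real.norm_eq_abs, abs_le]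
      constructor <;> linarith [(hφI k y).1, (hφI k y).2]
    · refine ae_of_all _ fun y => tendsto_const_nhds.congr' ?_
      obtain ⟨K, hK⟩ := exists_mem_compactCovering y
      filter_upwards [eventually_ge_atTop K] with k hk
      have : φ k y = 1 := hφ1 k (compactCovering_subset X hk hK)
      simp [this]
  rw [integral_zero] at hlim
  obtain ⟨k, hk⟩ := (hlim.eventually (gt_mem_nhds hδ)).exists
  exact ⟨φ k, hφc k, hφI k, hk⟩

/-- If `νₙ → μ` weakly and the integrals of a continuous weight `w` converge, then `∫ gₙ dνₙ`
converges to `∫ g dμ` whenever `gₙ → g` locally uniformly with a common bound by a multiple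
of `w`. -/
theorem tendsto_integral_of_weight_bound [R1Space X] [LocallyCompactSpace X] [SigmaCompactSpace X]
    {ν : ℕ → Measure X} {μ : Measure X} [∀ n, IsProbabilityMeasure (ν n)]
    {w : X → ℝ} (hwcont : Continuous w)
    (hwν : ∀ n, Integrable w (ν n)) (hwμ : Integrable w μ)
    (hweak : ∀ g : BoundedContinuousFunction X ℝ,
      Tendsto (fun n => ∫ y, g y ∂(ν n)) atTop (𝓝 (∫ y, g y ∂μ)))
    (hw : Tendsto (fun n => ∫ y, w y ∂(ν n)) atTop (𝓝 (∫ y, w y ∂μ)))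
    {g : ℕ → X → ℝ} {g0 : X → ℝ} (hgm : ∀ n, Measurable (g n)) (hg0 : Continuous g0)
    (hgg : TendstoLocallyUniformly g g0 atTop)
    {C : ℝ} (hC : 0 ≤ C) (hgb : ∀ n x, |g n x| ≤ C * w x) (hg0b : ∀ x, |g0 x| ≤ C * w x) :
    Tendsto (fun n => ∫ y, g n y ∂(ν n)) atTop (𝓝 (∫ y, g0 y ∂μ)) := by
  refine Metric.tendsto_nhds.2 fun ε hε => ?_
  obtain ⟨δ, hδ, hδε⟩ : ∃ δ > 0, (2 + 2 * C) * δ < ε := by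
    refine ⟨ε / (3 + 2 * C), by positivity, ?_⟩
    rw [mul_div_assoc', div_lt_iff₀ (by positivity)]
    nlinarith
  obtain ⟨φ, hφc, hφI, hφδ⟩ := exists_hasCompactSupport_integral_one_sub_mul_lt hwμ hδ
  have hφle : ∀ y, ‖φ y‖ ≤ 1 := fun y => by
    rw [Real.norm_eq_abs, abs_of_nonneg (hφI y).1]
    exact (hφI y).2
  have cutoff : ∀ {ρ : Measure X} {f : X → ℝ}, Integrable f ρ →
      Integrable (fun y => φ y * f y) ρ := fun hf =>
    hf.bdd_mul φ.continuous.measurable.aestronglyMeasurable (ae_of_all _ hφle)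
  have split : ∀ {ρ : Measure X} {f : X → ℝ}, Integrable f ρ →
      Integrable (fun y => (1 - φ y) * f y) ρ ∧
        ∫ y, (1 - φ y) * f y ∂ρ = ∫ y, f y ∂ρ - ∫ y, φ y * f y ∂ρ := by
    intro ρ f hf
    have he : (fun y => (1 - φ y) * f y) = fun y => f y - φ y * f y := by
      funext y; ring
    rw [he]
    exact ⟨hf.sub (cutoff hf), integral_sub hf (cutoff hf)⟩
  have dominated : ∀ {ρ : Measure X} {f : X → ℝ}, Integrable w ρ → Measurable f →
      (∀ x, |f x| ≤ C * w x) → Integrable f ρ ∧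
        |∫ y, (1 - φ y) * f y ∂ρ| ≤ C * ∫ y, (1 - φ y) * w y ∂ρ := by
    intro ρ f hwρ hf hfb
    refine ⟨(hwρ.const_mul C).mono' hf.aestronglyMeasurable (ae_of_all _ hfb), ?_⟩
    rw [← integral_const_mul, ← Real.norm_eq_abs]
    refine norm_integral_le_of_norm_le ((split hwρ).1.const_mul C) (ae_of_all _ fun y => ?_)
    have h1 : 0 ≤ 1 - φ y := sub_nonneg.2 (hφI y).2
    rw [norm_mul, Real.norm_eq_abs, Real.norm_eq_abs, abs_of_nonneg h1]
    calc (1 - φ y) * |f y| ≤ (1 - φ y) * (C * w y) := mul_le_mul_of_nonneg_left (hfb y) h1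
      _ = C * ((1 - φ y) * w y) := by ring
  have hwcut : Tendsto (fun n => ∫ y, (1 - φ y) * w y ∂(ν n)) atTop
      (𝓝 (∫ y, (1 - φ y) * w y ∂μ)) := by
    simp only [fun n => (split (hwν n)).2, (split hwμ).2]
    exact hw.sub (tendsto_integral_of_hasCompactSupport hweak
      (φ.continuous.mul hwcont) hφc.mul_right)
  have hgcut : Tendsto (fun n => ∫ y, φ y * g0 y ∂(ν n)) atTop (𝓝 (∫ y, φ y * g0 y ∂μ)) :=
    tendsto_integral_of_hasCompactSupport hweak (φ.continuous.mul hg0) hφc.mul_right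
  have hunif : TendstoUniformlyOn g g0 atTop (tsupport φ) :=
    (tendstoLocallyUniformlyOn_iff_tendstoUniformlyOn_of_compact hφc).1
      hgg.tendstoLocallyUniformlyOn
  filter_upwards [hwcut.eventually (gt_mem_nhds hφδ),
    Metric.tendsto_nhds.1 hgcut δ hδ, Metric.tendstoUniformlyOn_iff.1 hunif δ hδ]
    with n hn1 hn2 hn3
  obtain ⟨hgi, hgtail⟩ := dominated (hwν n) (hgm n) (hgb n)
  obtain ⟨hg0i, -⟩ := dominated (hwν n) hg0.measurable hg0b
  obtain ⟨hg0iμ, hg0tail⟩ := dominated hwμ hg0.measurable hg0b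
  have hmid : |∫ y, φ y * g n y ∂(ν n) - ∫ y, φ y * g0 y ∂(ν n)| ≤ δ := by
    rw [← integral_sub (cutoff hgi) (cutoff hg0i)]
    have hb : ∀ y, ‖φ y * g n y - φ y * g0 y‖ ≤ δ := fun y => by
      rw [← mul_sub, norm_mul]
      by_cases hy : y ∈ tsupport φ
      · have := hn3 y hy
        rw [dist_comm, Real.dist_eq] at this
        exact (mul_le_of_le_one_left (norm_nonneg _) (hφle y)).trans this.le
      · rw [image_eq_zero_of_notMem_tsupport hy]
        simpa using hδ.le
    simpa using norm_integral_le_of_norm_le_const (μ := ν n) (ae_of_all _ hb)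
  rw [(split hgi).2] at hgtail
  rw [(split hg0iμ).2] at hg0tail
  rw [Real.dist_eq] at hn2 ⊢
  have hC1 := mul_le_mul_of_nonneg_left hn1.le hC
  have hC2 := mul_le_mul_of_nonneg_left hφδ.le hC
  rw [abs_le] at hgtail hg0tail hmid
  rw [abs_lt] at hn2 ⊢
  constructor <;> linarith [hgtail.1, hgtail.2, hg0tail.1, hg0tail.2, hmid.1, hmid.2, hn2.1, hn2.2]

end WeightedWeakConvergence

/-- Continuous convergence of the Bellman operands: with
`Gₙ(x,a) = c(x,a) + β ∫ qₙ(y) pₙ(dy|x,a)` and `G(x,a) = c(x,a) + β ∫ q(y) p(dy|x,a)`,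
if `pₙ(·|xₙ,aₙ) → p(·|x,a)` weakly together with the `w_max`-integrals, `qₙ → q`
continuously with uniform `w_max`-bounds, then `Gₙ → G` continuously on `X × A`;
in particular `sup_{a∈A} |Gₙ(xₙ,a) − G(x,a)| → 0` and
`min_{a∈A} Gₙ(xₙ,a) → min_{a∈A} G(x,a)` whenever `xₙ → x`. -/
theorem statement8 {X A : Type*}
    [MetricSpace X] [LocallyCompactSpace X] [PolishSpace X]
    [MeasurableSpace X] [BorelSpace X]
    [MetricSpace A] [CompactSpace A] [Nonempty A] [MeasurableSpace A] [BorelSpace A]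
    (β : ℝ) (hβ : β ∈ Set.Ioo (0 : ℝ) 1)
    (c : X × A → ℝ) (hccont : Continuous c) (hc0 : ∀ q, 0 ≤ c q)
    (wmax : X → ℝ) (hwcont : Continuous wmax) (hw1 : ∀ x, 1 ≤ wmax x)
    (p : ℕ → Kernel (X × A) X) (p0 : Kernel (X × A) X)
    (hp : ∀ n, IsMarkovKernel (p n)) (hp0 : IsMarkovKernel p0)
    (hwint : ∀ n q, Integrable wmax (p n q)) (hwint0 : ∀ q, Integrable wmax (p0 q))
    (hpweak : ∀ (z : ℕ → X × A) (q : X × A), Tendsto z atTop (𝓝 q) →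
      ∀ g : BoundedContinuousFunction X ℝ,
        Tendsto (fun n => ∫ y, g y ∂(p n (z n))) atTop (𝓝 (∫ y, g y ∂(p0 q))))
    (hpw : ∀ (z : ℕ → X × A) (q : X × A), Tendsto z atTop (𝓝 q) →
      Tendsto (fun n => ∫ y, wmax y ∂(p n (z n))) atTop (𝓝 (∫ y, wmax y ∂(p0 q))))
    (qn : ℕ → X → ℝ) (q0 : X → ℝ)
    (hqmeas : ∀ n, Measurable (qn n)) (hq0meas : Measurable q0)
    (hqcc : ∀ (xs : ℕ → X) (x : X), Tendsto xs atTop (𝓝 x) →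
      Tendsto (fun n => qn n (xs n)) atTop (𝓝 (q0 x)))
    (hqbd : ∃ C : ℝ, ∀ n x, |qn n x| ≤ C * wmax x)
    (hq0bd : ∃ C : ℝ, ∀ x, |q0 x| ≤ C * wmax x) :
    -- Gₙ → G continuously on X × A
    (∀ (z : ℕ → X × A) (q : X × A), Tendsto z atTop (𝓝 q) →
      Tendsto (fun n => c (z n) + β * ∫ y, qn n y ∂(p n (z n))) atTop
        (𝓝 (c q + β * ∫ y, q0 y ∂(p0 q)))) ∧
    -- uniform convergence over a ∈ A
    (∀ (xs : ℕ → X) (x : X), Tendsto xs atTop (𝓝 x) →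
      Tendsto (fun n => ⨆ a : A,
          |(c (xs n, a) + β * ∫ y, qn n y ∂(p n (xs n, a))) -
            (c (x, a) + β * ∫ y, q0 y ∂(p0 (x, a)))|) atTop (𝓝 0)) ∧
    -- convergence of minima over A
    (∀ (xs : ℕ → X) (x : X), Tendsto xs atTop (𝓝 x) →
      Tendsto (fun n => ⨅ a : A, (c (xs n, a) + β * ∫ y, qn n y ∂(p n (xs n, a)))) atTop
        (𝓝 (⨅ a : A, (c (x, a) + β * ∫ y, q0 y ∂(p0 (x, a)))))) := by
  have hq0cont : Continuous q0 := continuous_of_seq_continuous_convergence hqcc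
  obtain ⟨C₁, hC₁⟩ := hqbd
  obtain ⟨C₂, hC₂⟩ := hq0bd
  set C := max (max C₁ C₂) 0
  have hw0 : ∀ x, 0 ≤ wmax x := fun x => zero_le_one.trans (hw1 x)
  have hqb : ∀ n x, |qn n x| ≤ C * wmax x := fun n x => (hC₁ n x).trans
    (mul_le_mul_of_nonneg_right ((le_max_left _ _).trans (le_max_left _ _)) (hw0 x))
  have hq0b : ∀ x, |q0 x| ≤ C * wmax x := fun x => (hC₂ x).trans
    (mul_le_mul_of_nonneg_right ((le_max_right _ _).trans (le_max_left _ _)) (hw0 x))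
  have hG : ∀ (z : ℕ → X × A) (q : X × A), Tendsto z atTop (𝓝 q) →
      Tendsto (fun n => c (z n) + β * ∫ y, qn n y ∂(p n (z n))) atTop
        (𝓝 (c q + β * ∫ y, q0 y ∂(p0 q))) := fun z q hz =>
    ((hccont.tendsto q).comp hz).add <| Tendsto.const_mul β <|
      tendsto_integral_of_weight_bound hwcont (fun n => hwint n (z n)) (hwint0 q)
        (hpweak z q hz) (hpw z q hz) hqmeas hq0cont
        (tendstoLocallyUniformly_of_seq_continuous_convergence hqcc) (le_max_right _ _) hqb hq0b
  have hA : ∀ (xs : ℕ → X) (x : X), Tendsto xs atTop (𝓝 x) →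
      ∀ (as : ℕ → A) (a : A), Tendsto as atTop (𝓝 a) →
      Tendsto (fun n => c (xs n, as n) + β * ∫ y, qn n y ∂(p n (xs n, as n))) atTop
        (𝓝 (c (x, a) + β * ∫ y, q0 y ∂(p0 (x, a)))) := fun xs x hx as a ha =>
    hG (fun n => (xs n, as n)) (x, a) (hx.prodMk_nhds ha)
  have hAunif : ∀ (xs : ℕ → X) (x : X), Tendsto xs atTop (𝓝 x) →
      TendstoUniformly (fun n a => c (xs n, a) + β * ∫ y, qn n y ∂(p n (xs n, a)))
        (fun a => c (x, a) + β * ∫ y, q0 y ∂(p0 (x, a))) atTop := fun xs x hx =>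
    tendstoLocallyUniformly_iff_tendstoUniformly_of_compactSpace.1
      (tendstoLocallyUniformly_of_seq_continuous_convergence
        (F := fun n a => c (xs n, a) + β * ∫ y, qn n y ∂(p n (xs n, a))) (hA xs x hx))
  refine ⟨hG, fun xs x hx => (hAunif xs x hx).tendsto_iSup_abs_sub, fun xs x hx =>
    (hAunif xs x hx).tendsto_iInf (isCompact_range ?_).bddBelow⟩
  exact continuous_of_seq_continuous_convergence
    (F := fun n a => c (xs n, a) + β * ∫ y, qn n y ∂(p n (xs n, a))) (hA xs x hx)
end

section
/- Let X be a Polish space. Let K_n and K be Markov kernels from X to X such that K_n(·|x_n) → K(·|x) weakly whenever x_n → x in X, and let μ_n → μ weakly in the space of Borel probability measures on X. Then the probability measures μ_n K_n, defined by (μ_n K_n)(B) = ∫_X K_n(B|x) μ_n(dx) for Borel B ⊆ X, converge weakly to μK. -/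
open Filter Topology MeasureTheory ProbabilityTheory

/-- Continuous convergence along sequences is joint convergence along `atTop ×ˢ 𝓝 x`. -/
lemma tendsto_uncurry_of_forall_seq {X Y : Type*} [TopologicalSpace X]
    [FirstCountableTopology X] [TopologicalSpace Y] {F : ℕ → X → Y} {x : X} {y : Y}
    (hF : ∀ xs : ℕ → X, Tendsto xs atTop (𝓝 x) →
      Tendsto (fun n => F n (xs n)) atTop (𝓝 y)) :
    Tendsto (fun p : ℕ × X => F p.1 p.2) (atTop ×ˢ 𝓝 x) (𝓝 y) := by
  refine tendsto_of_subseq_tendsto fun u hu => ?_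
  have hu1 : Tendsto (fun k => (u k).1) atTop atTop := tendsto_fst.comp hu
  have hu2 : Tendsto (fun k => (u k).2) atTop (𝓝 x) := tendsto_snd.comp hu
  obtain ⟨φ, hφ, hφ1⟩ := strictMono_subseq_of_tendsto_atTop hu1
  refine ⟨φ, ?_⟩
  set ψ : ℕ → ℕ := fun k => (u (φ k)).1
  have hψ : StrictMono ψ := hφ1
  set xs : ℕ → X := Function.extend ψ (fun k => (u (φ k)).2) fun _ => x with hxs
  have hxs_apply (k : ℕ) : xs (ψ k) = (u (φ k)).2 := hψ.injective.extend_apply _ _ k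
  have hlim : Tendsto xs atTop (𝓝 x) := by
    intro s hs
    obtain ⟨k₀, hk₀⟩ := eventually_atTop.1
      ((hu2.comp hφ.tendsto_atTop).eventually (eventually_mem_set.2 hs))
    refine mem_map.2 (mem_atTop_sets.2 ⟨ψ k₀, fun n hn => ?_⟩)
    by_cases h : ∃ k, ψ k = n
    · obtain ⟨k, rfl⟩ := h
      rw [Set.mem_preimage, hxs_apply]
      exact hk₀ k (hψ.le_iff_le.1 hn)
    · rw [Set.mem_preimage, hxs, Function.extend_apply' _ _ _ h]
      exact mem_of_mem_nhds hs
  refine ((hF xs hlim).comp hψ.tendsto_atTop).congr fun k => ?_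
  simp only [Function.comp_apply, hxs_apply]
  rfl

/-- The `m`-Lipschitz lower envelope of the functions `F n` with `m ≤ n`. -/
noncomputable def lowerLipschitzEnvelope {X : Type*} [PseudoMetricSpace X] (F : ℕ → X → ℝ)
    (m : ℕ) (x : X) : ℝ :=
  ⨅ p : Set.Ici m × X, (F p.1 p.2 + m * dist x p.2)

section Envelope

variable {X : Type*} [PseudoMetricSpace X] {F : ℕ → X → ℝ} {C : ℝ}

lemma bddBelow_lowerLipschitzEnvelope (hC : ∀ n x, |F n x| ≤ C) (m : ℕ) (x : X) :
    BddBelow (Set.range fun p : Set.Ici m × X => F p.1 p.2 + m * dist x p.2) := by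
  refine ⟨-C, ?_⟩
  rintro _ ⟨p, rfl⟩
  have := (abs_le.1 (hC p.1 p.2)).1
  have : 0 ≤ (m : ℝ) * dist x p.2 := by positivity
  dsimp only
  linarith

lemma lowerLipschitzEnvelope_le (hC : ∀ n x, |F n x| ≤ C) {m n : ℕ} (hmn : m ≤ n) (x : X) :
    lowerLipschitzEnvelope F m x ≤ F n x := by
  refine (ciInf_le (bddBelow_lowerLipschitzEnvelope hC m x) (⟨n, hmn⟩, x)).trans ?_
  simp

lemma abs_lowerLipschitzEnvelope_le (hC : ∀ n x, |F n x| ≤ C) (m : ℕ) (x : X) :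
    |lowerLipschitzEnvelope F m x| ≤ C := by
  have : Nonempty X := ⟨x⟩
  refine abs_le.2 ⟨le_ciInf fun p => ?_,
    (lowerLipschitzEnvelope_le hC le_rfl x).trans (abs_le.1 (hC m x)).2⟩
  have := (abs_le.1 (hC p.1 p.2)).1
  have : 0 ≤ (m : ℝ) * dist x p.2 := by positivity
  linarith

lemma lipschitzWith_lowerLipschitzEnvelope (hC : ∀ n x, |F n x| ≤ C) (m : ℕ) :
    LipschitzWith m (lowerLipschitzEnvelope F m) := by
  refine LipschitzWith.of_le_add_mul _ fun x y => ?_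
  have : Nonempty X := ⟨x⟩
  rw [← sub_le_iff_le_add]
  refine le_ciInf fun p => ?_
  have h1 := ciInf_le (bddBelow_lowerLipschitzEnvelope hC m x) p
  have h2 : (m : ℝ) * dist x p.2 ≤ m * (dist x y + dist y p.2) := by
    gcongr
    exact dist_triangle _ _ _
  have h3 : lowerLipschitzEnvelope F m x ≤ F p.1 p.2 + m * dist x p.2 := h1
  simp only [NNReal.coe_natCast]
  linarith

lemma tendsto_lowerLipschitzEnvelope (hC : ∀ n x, |F n x| ≤ C) {x : X} {a : ℝ}
    (hF : Tendsto (fun p : ℕ × X => F p.1 p.2) (atTop ×ˢ 𝓝 x) (𝓝 a)) :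
    Tendsto (fun m => lowerLipschitzEnvelope F m x) atTop (𝓝 a) := by
  have : Nonempty X := ⟨x⟩
  have hpt : Tendsto (fun n => F n x) atTop (𝓝 a) :=
    hF.comp (tendsto_id.prodMk tendsto_const_nhds)
  have ha : a ≤ C := le_of_tendsto' hpt fun n => (abs_le.1 (hC n x)).2
  refine tendsto_order.2 ⟨fun b hb => ?_, fun b hb => ?_⟩
  · obtain ⟨c, hbc, hca⟩ := exists_between hb
    obtain ⟨P, hP, Q, hQ, hPQ⟩ := eventually_prod_iff.1 (hF.eventually (lt_mem_nhds hca))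
    obtain ⟨N, hN⟩ := eventually_atTop.1 hP
    obtain ⟨δ, hδ, hball⟩ := Metric.eventually_nhds_iff.1 hQ
    obtain ⟨M, hM⟩ := exists_nat_gt (2 * C / δ)
    filter_upwards [eventually_ge_atTop N, eventually_ge_atTop M] with m hmN hmM
    refine hbc.trans_le (le_ciInf fun p => ?_)
    have hnn : 0 ≤ (m : ℝ) * dist x p.2 := by positivity
    by_cases hd : dist p.2 x < δ
    · have : c < F p.1 p.2 := hPQ (hN _ (hmN.trans p.1.2)) (hball hd)
      linarith
    · have h1 : 2 * C < M * δ := (div_lt_iff₀ hδ).1 hM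
      have h2 : (M : ℝ) * δ ≤ m * dist x p.2 := by
        rw [dist_comm]
        have : (M : ℝ) ≤ m := by exact_mod_cast hmM
        gcongr
        exact not_lt.1 hd
      have h3 := (abs_le.1 (hC p.1 p.2)).1
      linarith
  · filter_upwards [hpt.eventually (gt_mem_nhds hb)] with m hm
    exact (lowerLipschitzEnvelope_le hC le_rfl x).trans_lt hm

end Envelope

/-- Lower half of the extended continuous mapping theorem for uniformly bounded functions. -/
lemma eventually_lt_integral_of_tendsto {X : Type*} [PseudoMetricSpace X] [MeasurableSpace X]
    [BorelSpace X] {F : ℕ → X → ℝ} {F0 : X → ℝ} {C : ℝ} (hC : ∀ n x, |F n x| ≤ C)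
    (hFm : ∀ n, Measurable (F n))
    (hF : ∀ x, Tendsto (fun p : ℕ × X => F p.1 p.2) (atTop ×ˢ 𝓝 x) (𝓝 (F0 x)))
    {μ : ℕ → Measure X} {μ0 : Measure X} [∀ n, IsProbabilityMeasure (μ n)]
    [IsProbabilityMeasure μ0]
    (hμ : ∀ g : BoundedContinuousFunction X ℝ,
      Tendsto (fun n => ∫ x, g x ∂(μ n)) atTop (𝓝 (∫ x, g x ∂μ0)))
    {b : ℝ} (hb : b < ∫ x, F0 x ∂μ0) :
    ∀ᶠ n in atTop, b < ∫ x, F n x ∂(μ n) := by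
  have hcont (m : ℕ) : Continuous (lowerLipschitzEnvelope F m) :=
    (lipschitzWith_lowerLipschitzEnvelope hC m).continuous
  have hlim : Tendsto (fun m => ∫ x, lowerLipschitzEnvelope F m x ∂μ0) atTop
      (𝓝 (∫ x, F0 x ∂μ0)) :=
    tendsto_integral_of_dominated_convergence (fun _ => C)
      (fun m => (hcont m).measurable.aestronglyMeasurable) (integrable_const C)
      (fun m => .of_forall fun x => abs_lowerLipschitzEnvelope_le hC m x)
      (.of_forall fun x => tendsto_lowerLipschitzEnvelope hC (hF x))
  obtain ⟨m, hm⟩ := (hlim.eventually (lt_mem_nhds hb)).exists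
  let g := BoundedContinuousFunction.ofNormedAddCommGroup (lowerLipschitzEnvelope F m) (hcont m) C
    (abs_lowerLipschitzEnvelope_le hC m)
  filter_upwards [(hμ g).eventually (lt_mem_nhds hm), eventually_ge_atTop m] with n hn hmn
  refine hn.trans_le (integral_mono (g.integrable (μ n)) ?_
    fun x => lowerLipschitzEnvelope_le hC hmn x)
  exact .of_bound (hFm n).aestronglyMeasurable C (.of_forall fun x => hC n x)

/-- If `Kₙ(·|xₙ) → K(·|x)` weakly whenever `xₙ → x`, and `μₙ → μ` weakly,
then `μₙKₙ → μK` weakly, where `(μK)(B) = ∫ K(B|x) μ(dx)`. -/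
theorem statement9 {X : Type*}
    [MetricSpace X] [PolishSpace X] [MeasurableSpace X] [BorelSpace X]
    (K : ℕ → Kernel X X) (K0 : Kernel X X)
    (hK : ∀ n, IsMarkovKernel (K n)) (hK0 : IsMarkovKernel K0)
    (hKweak : ∀ (xs : ℕ → X) (x : X), Tendsto xs atTop (𝓝 x) →
      ∀ g : BoundedContinuousFunction X ℝ,
        Tendsto (fun n => ∫ y, g y ∂(K n (xs n))) atTop (𝓝 (∫ y, g y ∂(K0 x))))
    (μ : ℕ → Measure X) (μ0 : Measure X)
    (hμ : ∀ n, IsProbabilityMeasure (μ n)) (hμ0 : IsProbabilityMeasure μ0)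
    (hμweak : ∀ g : BoundedContinuousFunction X ℝ,
      Tendsto (fun n => ∫ x, g x ∂(μ n)) atTop (𝓝 (∫ x, g x ∂μ0))) :
    ∀ g : BoundedContinuousFunction X ℝ,
      Tendsto (fun n => ∫ x, g x ∂((μ n).bind (K n))) atTop
        (𝓝 (∫ x, g x ∂(μ0.bind K0))) := by
  have hbind (ν : Measure X) (κ : Kernel X X) (hν : IsProbabilityMeasure ν)
      (hκ : IsMarkovKernel κ) (g : BoundedContinuousFunction X ℝ) :
      ∫ x, g x ∂(ν.bind κ) = ∫ x, ∫ y, g y ∂(κ x) ∂ν :=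
    Kernel.integral_comp (κ := Kernel.const Unit ν) (η := κ) (a := ()) (g.integrable _)
  have hlower (g : BoundedContinuousFunction X ℝ) (b : ℝ) (hb : b < ∫ x, g x ∂(μ0.bind K0)) :
      ∀ᶠ n in atTop, b < ∫ x, g x ∂((μ n).bind (K n)) := by
    rw [hbind _ _ hμ0 hK0] at hb
    simp only [fun n => hbind _ _ (hμ n) (hK n) g]
    refine eventually_lt_integral_of_tendsto (C := ‖g‖) (fun n x => ?_) (fun n => ?_)
      (fun x => tendsto_uncurry_of_forall_seq fun xs hxs => hKweak xs x hxs g) hμweak hb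
    · exact g.norm_integral_le_norm (K n x)
    · exact (g.continuous.stronglyMeasurable.integral_kernel (κ := K n)).measurable
  refine fun g => tendsto_order.2 ⟨hlower g, fun b hb => ?_⟩
  have h := hlower (-g) (-b)
  simp only [BoundedContinuousFunction.coe_neg, Pi.neg_apply, integral_neg, neg_lt_neg_iff] at h
  exact h hb
end

section
/- Let X be a Polish space. Let K_n and K be Markov kernels from X to X such that K_n(·|x_n) → K(·|x) weakly whenever x_n → x in X, and let μ_n → μ weakly in the space of Borel probability measures on X. If each μ_n is invariant for K_n, i.e. μ_n(B) = ∫_X K_n(B|x) μ_n(dx) for every Borel B ⊆ X, then μ is invariant for K, i.e. μ(B) = ∫_X K(B|x) μ(dx) for every Borel B ⊆ X. -/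
open Filter Topology MeasureTheory ProbabilityTheory

/-- Filling in a subsequence converging to `x` by the constant value `x` gives a full sequence
converging to `x`. -/
theorem tendsto_extend_const_of_strictMono {X : Type*} [TopologicalSpace X] {φ : ℕ → ℕ}
    (hφ : StrictMono φ) {y : ℕ → X} {x : X} (hy : Tendsto y atTop (𝓝 x)) :
    Tendsto (Function.extend φ y fun _ => x) atTop (𝓝 x) := by
  intro U hU
  obtain ⟨k₀, hk₀⟩ := eventually_atTop.1 (hy hU)
  refine eventually_atTop.2 ⟨φ k₀, fun m hm => ?_⟩
  by_cases h : ∃ k, φ k = m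
  · obtain ⟨k, rfl⟩ := h
    rw [hφ.injective.extend_apply]
    exact hk₀ k (hφ.le_iff_le.1 hm)
  · rw [Function.extend_apply' _ _ _ h]
    exact mem_of_mem_nhds hU

/-- A property of pairs `(n, y)` which holds eventually along every sequence converging to `x`
holds for all large `n` and all `y` near `x`. -/
theorem eventually_prod_nhds_of_forall_seq {X : Type*} [TopologicalSpace X]
    [FirstCountableTopology X] {p : ℕ → X → Prop} {x : X}
    (h : ∀ xs : ℕ → X, Tendsto xs atTop (𝓝 x) → ∀ᶠ n in atTop, p n (xs n)) :
    ∀ᶠ z : ℕ × X in atTop ×ˢ 𝓝 x, p z.1 z.2 := by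
  by_contra hcon
  obtain ⟨zs, hzs, hp⟩ := exists_seq_forall_of_frequently (not_eventually.1 hcon)
  rw [tendsto_prod_iff'] at hzs
  obtain ⟨ψ, hψ, hφ⟩ := strictMono_subseq_of_tendsto_atTop hzs.1
  have hev := h _ (tendsto_extend_const_of_strictMono hφ (hzs.2.comp hψ.tendsto_atTop))
  obtain ⟨k, hk⟩ := (hφ.tendsto_atTop.eventually hev).exists
  rw [hφ.injective.extend_apply] at hk
  exact hp _ hk

/-- If `fₙ(y) > t` for large `n` and `y` near any point of `{f > t}`, then
`μ {f > t} ≤ liminf μₙ {fₙ > t}` as soon as `μ U ≤ liminf μₙ U` for every open `U`. -/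
theorem measure_lt_le_liminf_measure_lt {X : Type*} [TopologicalSpace X] [MeasurableSpace X]
    {μ : ℕ → Measure X} {μ0 : Measure X}
    (hμ : ∀ U, IsOpen U → μ0 U ≤ liminf (fun n => μ n U) atTop)
    {f : ℕ → X → ℝ} {f0 : X → ℝ} {t : ℝ}
    (hf : ∀ x, t < f0 x → ∀ᶠ z : ℕ × X in atTop ×ˢ 𝓝 x, t < f z.1 z.2) :
    μ0 {x | t < f0 x} ≤ liminf (fun n => μ n {x | t < f n x}) atTop := by
  let U : ℕ → Set X := fun N => interior {y | ∀ n ≥ N, t < f n y}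
  have hU : Monotone U := fun M N hMN =>
    interior_mono fun y hy n hn => hy n (hMN.trans hn)
  have hsub : {x | t < f0 x} ⊆ ⋃ N, U N := by
    intro x hx
    obtain ⟨p, hp, q, hq, hpq⟩ := eventually_prod_iff.1 (hf x hx)
    obtain ⟨N, hN⟩ := eventually_atTop.1 hp
    refine Set.mem_iUnion.2 ⟨N, mem_interior_iff_mem_nhds.2 ?_⟩
    filter_upwards [hq] with y hy n hn using hpq (hN n hn) hy
  refine (measure_mono hsub).trans ?_
  rw [hU.measure_iUnion]
  refine iSup_le fun N => (hμ _ isOpen_interior).trans (liminf_le_liminf ?_)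
  filter_upwards [eventually_ge_atTop N] with n hn
  exact measure_mono fun y hy => interior_subset hy n hn

/-- Weak convergence gives `μ U ≤ liminf μₙ U` for open `U`. -/
theorem measure_isOpen_le_liminf_of_forall_integral_tendsto {X : Type*} [TopologicalSpace X]
    [MeasurableSpace X] [OpensMeasurableSpace X] [HasOuterApproxClosed X]
    {μ : ℕ → Measure X} {μ0 : Measure X}
    [hμ : ∀ n, IsProbabilityMeasure (μ n)] [hμ0 : IsProbabilityMeasure μ0]
    (h : ∀ g : BoundedContinuousFunction X ℝ,
      Tendsto (fun n => ∫ x, g x ∂(μ n)) atTop (𝓝 (∫ x, g x ∂μ0)))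
    {U : Set X} (hU : IsOpen U) : μ0 U ≤ liminf (fun n => μ n U) atTop := by
  let P : ℕ → ProbabilityMeasure X := fun n => ⟨μ n, hμ n⟩
  let P0 : ProbabilityMeasure X := ⟨μ0, hμ0⟩
  have hlim : Tendsto P atTop (𝓝 P0) :=
    ProbabilityMeasure.tendsto_iff_forall_integral_tendsto.2 h
  exact ProbabilityMeasure.le_liminf_measure_open_of_tendsto hlim hU

/-- The measure of a set under a kernel, integrated by the layer cake formula. -/
theorem lintegral_kernel_eq_lintegral_measure_lt {X Y : Type*} [MeasurableSpace X]
    [MeasurableSpace Y] (K : Kernel X Y) [IsMarkovKernel K] (μ : Measure X)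
    {B : Set Y} (hB : MeasurableSet B) :
    ∫⁻ x, K x B ∂μ = ∫⁻ t in Set.Ioi (0 : ℝ), μ {x | t < (K x).real B} := by
  rw [← lintegral_eq_lintegral_meas_lt μ (Eventually.of_forall fun x => measureReal_nonneg)
    (K.measurable_coe hB).ennreal_toReal.aemeasurable]
  simp

/-- If `Kₙ(·|xₙ) → K(·|x)` weakly whenever `xₙ → x`, `μₙ → μ` weakly, and
each `μₙ` is invariant for `Kₙ`, then `μ` is invariant for `K`. -/
theorem statement10 {X : Type*}
    [MetricSpace X] [PolishSpace X] [MeasurableSpace X] [BorelSpace X]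
    (K : ℕ → Kernel X X) (K0 : Kernel X X)
    (hK : ∀ n, IsMarkovKernel (K n)) (hK0 : IsMarkovKernel K0)
    (hKweak : ∀ (xs : ℕ → X) (x : X), Tendsto xs atTop (𝓝 x) →
      ∀ g : BoundedContinuousFunction X ℝ,
        Tendsto (fun n => ∫ y, g y ∂(K n (xs n))) atTop (𝓝 (∫ y, g y ∂(K0 x))))
    (μ : ℕ → Measure X) (μ0 : Measure X)
    (hμ : ∀ n, IsProbabilityMeasure (μ n)) (hμ0 : IsProbabilityMeasure μ0)
    (hμweak : ∀ g : BoundedContinuousFunction X ℝ,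
      Tendsto (fun n => ∫ x, g x ∂(μ n)) atTop (𝓝 (∫ x, g x ∂μ0)))
    (hinv : ∀ n, ∀ B : Set X, MeasurableSet B →
      μ n B = ∫⁻ x, K n x B ∂(μ n)) :
    ∀ B : Set X, MeasurableSet B → μ0 B = ∫⁻ x, K0 x B ∂μ0 := by
  have hopen : ∀ U, IsOpen U → μ0.bind K0 U ≤ liminf (fun n => μ n U) atTop := by
    intro U hU
    have hμU : ∀ V, IsOpen V → μ0 V ≤ liminf (fun n => μ n V) atTop := fun V hV =>
      measure_isOpen_le_liminf_of_forall_integral_tendsto hμweak hV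
    have hlevel : ∀ t : ℝ, 0 < t → μ0 {x | t < (K0 x).real U} ≤
        liminf (fun n => μ n {x | t < (K n x).real U}) atTop := by
      intro t ht
      refine measure_lt_le_liminf_measure_lt hμU (f := fun n x => (K n x).real U) fun x hx =>
        eventually_prod_nhds_of_forall_seq (p := fun n y => t < (K n y).real U) fun xs hxs => ?_
      have hlt : ENNReal.ofReal t < liminf (fun n => K n (xs n) U) atTop :=
        ((ENNReal.ofReal_lt_iff_lt_toReal ht.le (measure_ne_top _ _)).2 hx).trans_le
          (measure_isOpen_le_liminf_of_forall_integral_tendsto (hKweak xs x hxs) hU)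
      filter_upwards [eventually_lt_of_lt_liminf hlt] with n hn
      exact (ENNReal.ofReal_lt_iff_lt_toReal ht.le (measure_ne_top _ _)).1 hn
    have hanti : ∀ n, Antitone fun t : ℝ => μ n {x | t < (K n x).real U} :=
      fun n s t hst => measure_mono fun x hx => hst.trans_lt hx
    calc μ0.bind K0 U = ∫⁻ x, K0 x U ∂μ0 :=
          Measure.bind_apply hU.measurableSet K0.aemeasurable
      _ = ∫⁻ t in Set.Ioi (0 : ℝ), μ0 {x | t < (K0 x).real U} :=
          lintegral_kernel_eq_lintegral_measure_lt K0 μ0 hU.measurableSet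
      _ ≤ ∫⁻ t in Set.Ioi (0 : ℝ),
            liminf (fun n => μ n {x | t < (K n x).real U}) atTop :=
          setLIntegral_mono' measurableSet_Ioi hlevel
      _ ≤ liminf (fun n => ∫⁻ t in Set.Ioi (0 : ℝ), μ n {x | t < (K n x).real U}) atTop :=
          lintegral_liminf_le fun n => (hanti n).measurable
      _ = liminf (fun n => μ n U) atTop := by
          simp_rw [← lintegral_kernel_eq_lintegral_measure_lt (K _) (μ _) hU.measurableSet,
            ← hinv _ U hU.measurableSet]
  let P : ℕ → ProbabilityMeasure X := fun n => ⟨μ n, hμ n⟩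
  let P0 : ProbabilityMeasure X := ⟨μ0, hμ0⟩
  let Q0 : ProbabilityMeasure X := ⟨μ0.bind K0, inferInstance⟩
  have hP0 : Tendsto P atTop (𝓝 P0) :=
    ProbabilityMeasure.tendsto_iff_forall_integral_tendsto.2 hμweak
  have hQ0 : Tendsto P atTop (𝓝 Q0) :=
    tendsto_of_forall_isOpen_le_liminf' hopen
  have hPQ : P0 = Q0 := tendsto_nhds_unique hP0 hQ0
  have heq : μ0 = μ0.bind K0 := congrArg Subtype.val hPQ
  intro B hB
  rw [← Measure.bind_apply hB K0.aemeasurable, ← heq]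
end

section
/- In the quantization setting, let A be a nonempty set, K₂ > 0, and p a Markov kernel from X × A to X with ‖p(·|x,a) − p(·|y,a)‖_TV ≤ K₂·d(x,y) for all a ∈ A and x, y ∈ X. Define p̂(·|x,a) = ∫_{S_{i(x)}} (T⋆p(·|z,a)) ν_{i(x)}(dz). Then for every bounded measurable g : X → ℝ and all (x,a) ∈ X × A: |∫_X g dp̂(·|x,a) − ∫_X g dp(·|x,a)| ≤ (2K₂/n)·sup_{t∈X}|g(t)| + sup_{t∈X} |g(T(t)) − g(t)|. -/
open Filter Topology MeasureTheory ProbabilityTheory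

/-- Total variation distance `‖μ − ν‖_TV = 2·sup_{Borel B} |μ(B) − ν(B)|`. -/
noncomputable def tvDist {X : Type*} [MeasurableSpace X]
    (μ ν : Measure X) : ℝ :=
  2 * ⨆ B : {s : Set X // MeasurableSet s}, |(μ ↑B).toReal - (ν ↑B).toReal|

section Auxiliary

variable {X : Type*} [MeasurableSpace X]

lemma integrable_of_abs_le {μ : Measure X} [IsFiniteMeasure μ] {g : X → ℝ} {C : ℝ}
    (hg : Measurable g) (hC : ∀ t, |g t| ≤ C) : Integrable g μ :=
  .of_bound hg.aestronglyMeasurable C (.of_forall hC)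

lemma abs_integral_le_of_abs_le {μ : Measure X} [IsProbabilityMeasure μ] {g : X → ℝ} {C : ℝ}
    (hC : ∀ᵐ t ∂μ, |g t| ≤ C) : |∫ t, g t ∂μ| ≤ C := by
  simpa using norm_integral_le_of_norm_le_const (μ := μ) (f := g) hC

lemma abs_integral_sub_integral_le_of_le {μ ν : Measure X} [IsFiniteMeasure μ]
    [IsFiniteMeasure ν] (hνμ : ν ≤ μ) {g : X → ℝ} {C : ℝ} (hg : Measurable g)
    (hC : ∀ t, |g t| ≤ C) :
    |∫ t, g t ∂μ - ∫ t, g t ∂ν| ≤ C * (μ.real Set.univ - ν.real Set.univ) := by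
  have hμ : μ = (μ - ν) + ν := (Measure.sub_add_cancel_of_le hνμ).symm
  have hint : ∫ t, g t ∂μ - ∫ t, g t ∂ν = ∫ t, g t ∂(μ - ν) := by
    conv_lhs => rw [hμ]
    rw [integral_add_measure (integrable_of_abs_le hg hC) (integrable_of_abs_le hg hC),
      add_sub_cancel_right]
  have hmass : μ.real Set.univ - ν.real Set.univ = (μ - ν).real Set.univ := by
    conv_lhs => rw [hμ]
    rw [measureReal_add_apply, add_sub_cancel_right]
  rw [hint, hmass]
  exact norm_integral_le_of_norm_le_const (f := g) (.of_forall hC)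

lemma two_mul_abs_sub_le_tvDist (μ ν : Measure X) [IsProbabilityMeasure μ]
    [IsProbabilityMeasure ν] {s : Set X} (hs : MeasurableSet s) :
    2 * |μ.real s - ν.real s| ≤ tvDist μ ν := by
  have hbdd : BddAbove (Set.range fun B : {s : Set X // MeasurableSet s} ↦
      |(μ ↑B).toReal - (ν ↑B).toReal|) := by
    refine ⟨1, ?_⟩
    rintro _ ⟨B, rfl⟩
    exact abs_sub_le_of_nonneg_of_le measureReal_nonneg measureReal_le_one
      measureReal_nonneg measureReal_le_one
  exact mul_le_mul_of_nonneg_left (le_ciSup hbdd ⟨s, hs⟩) zero_le_two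

lemma abs_integral_sub_integral_le_mul_tvDist (μ ν : Measure X) [IsProbabilityMeasure μ]
    [IsProbabilityMeasure ν] {g : X → ℝ} {C : ℝ} (hg : Measurable g)
    (hC₀ : 0 ≤ C) (hC : ∀ t, |g t| ≤ C) :
    |∫ t, g t ∂μ - ∫ t, g t ∂ν| ≤ C * tvDist μ ν := by
  obtain ⟨s, hs⟩ := exists_isHahnDecomposition μ ν
  have h₁ := abs_integral_sub_integral_le_of_le hs.le_on hg hC
  have h₂ := abs_integral_sub_integral_le_of_le hs.ge_on_compl hg hC
  rw [abs_sub_comm] at h₁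
  simp only [measureReal_restrict_apply_univ, probReal_compl_eq_one_sub hs.measurableSet]
    at h₁ h₂
  rw [← integral_add_compl hs.measurableSet (integrable_of_abs_le (μ := μ) hg hC),
    ← integral_add_compl hs.measurableSet (integrable_of_abs_le (μ := ν) hg hC),
    add_sub_add_comm]
  have htv : 2 * (ν.real s - μ.real s) ≤ tvDist μ ν :=
    (mul_le_mul_of_nonneg_left (neg_sub (μ.real s) _ ▸ neg_le_abs _) zero_le_two).trans
      (two_mul_abs_sub_le_tvDist μ ν hs.measurableSet)
  calc _ ≤ _ := abs_add_le _ _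
    _ ≤ C * (ν.real s - μ.real s) + C * (1 - μ.real s - (1 - ν.real s)) := add_le_add h₁ h₂
    _ = C * (2 * (ν.real s - μ.real s)) := by ring
    _ ≤ C * tvDist μ ν := mul_le_mul_of_nonneg_left htv hC₀

lemma integral_bind_kernel {Y : Type*} [MeasurableSpace Y] (μ : Measure X) (κ : Kernel X Y)
    {g : Y → ℝ} (hg : Integrable g (μ.bind κ)) :
    ∫ y, g y ∂(μ.bind κ) = ∫ x, ∫ y, g y ∂(κ x) ∂μ := by
  have h : μ.bind κ = (κ ∘ₖ Kernel.const Unit μ) () := by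
    rw [Kernel.comp_apply, Kernel.const_apply]
  rw [h] at hg ⊢
  rw [Kernel.integral_comp hg, Kernel.const_apply]

end Auxiliary

/-- In the quantization setting, if
`‖p(·|x,a) − p(·|y,a)‖_TV ≤ K₂·d(x,y)`, then the quantized kernel
`p̂(·|x,a) = ∫_{S_{i(x)}} T⋆p(·|z,a) ν_{i(x)}(dz)` satisfies, for every bounded measurable
`g`, `|∫ g dp̂(·|x,a) − ∫ g dp(·|x,a)| ≤ (2K₂/n)·sup|g| + sup_t |g(T t) − g(t)|`. -/
theorem statement12 {X A : Type*} [MetricSpace X] [CompactSpace X]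
    [MeasurableSpace X] [BorelSpace X] [MeasurableSpace A] [Nonempty A]
    (n : ℕ) (hn : 1 ≤ n)
    (T : X → X) (hTmeas : Measurable T) (hTfin : (Set.range T).Finite)
    (hTd : ∀ x, dist x (T x) ≤ 1 / (n : ℝ))
    (ν : X → Measure X)
    (hν : ∀ x, IsProbabilityMeasure (ν (T x)))
    (hνcell : ∀ x, ν (T x) {z | T z = T x} = 1)
    (K₂ : ℝ) (hK₂ : 0 < K₂)
    (p : Kernel (X × A) X) [IsMarkovKernel p]
    (hpLip : ∀ (a : A) (x y : X), tvDist (p (x, a)) (p (y, a)) ≤ K₂ * dist x y)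
    (g : X → ℝ) (hgmeas : Measurable g) (hgbd : ∃ C : ℝ, ∀ t, |g t| ≤ C) :
    ∀ (x : X) (a : A),
      |(∫ t, g t ∂(((ν (T x)).restrict {z | T z = T x}).bind
            fun z => (p (z, a)).map T)) - ∫ t, g t ∂(p (x, a))| ≤
        2 * K₂ / (n : ℝ) * (⨆ t : X, |g t|) + ⨆ t : X, |g (T t) - g t| := by
  intro x a
  obtain ⟨D, hD⟩ := hgbd
  set C := ⨆ t : X, |g t|
  set E := ⨆ t : X, |g (T t) - g t|
  have hC : ∀ t, |g t| ≤ C := le_ciSup ⟨D, Set.forall_mem_range.2 hD⟩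
  have hC₀ : 0 ≤ C := (abs_nonneg _).trans (hC x)
  have hE : ∀ t, |g (T t) - g t| ≤ E := le_ciSup ⟨D + D, Set.forall_mem_range.2 fun t ↦
    (abs_sub _ _).trans (add_le_add (hD _) (hD _))⟩
  have hgT : Measurable fun t ↦ g (T t) := hgmeas.comp hTmeas
  have hcell : MeasurableSet {z | T z = T x} := hTmeas (measurableSet_singleton (T x))
  set ρ := (ν (T x)).restrict {z | T z = T x}
  have : IsProbabilityMeasure ρ := ⟨by rw [Measure.restrict_apply_univ, hνcell]⟩
  let κ : Kernel X X := (p.comap (fun z ↦ (z, a)) (by fun_prop)).map T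
  have : IsMarkovKernel κ := Kernel.IsMarkovKernel.map _ hTmeas
  have hκ : (fun z ↦ (p (z, a)).map T) = κ := by
    ext1 z
    rw [Kernel.map_apply _ hTmeas, Kernel.comap_apply]
  have hκint (z : X) : ∫ t, g t ∂κ z = ∫ t, g (T t) ∂p (z, a) := by
    rw [← hκ, integral_map hTmeas.aemeasurable hgmeas.aestronglyMeasurable]
  have hint : Integrable (fun z ↦ ∫ t, g t ∂κ z) ρ :=
    .of_bound hgmeas.stronglyMeasurable.integral_kernel.aestronglyMeasurable C
      (.of_forall fun z ↦ abs_integral_le_of_abs_le (.of_forall hC))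
  rw [hκ, integral_bind_kernel ρ κ (integrable_of_abs_le hgmeas hC)]
  have hsub : ∫ z, ∫ t, g t ∂κ z ∂ρ - ∫ t, g t ∂p (x, a) =
      ∫ z, (∫ t, g t ∂κ z - ∫ t, g t ∂p (x, a)) ∂ρ := by
    rw [integral_sub hint (integrable_const _)]
    simp
  rw [hsub]
  apply abs_integral_le_of_abs_le
  filter_upwards [ae_restrict_mem hcell] with z hz
  have hdist : dist z x ≤ 2 / n := by
    have hz' : dist z (T x) ≤ 1 / n := hz ▸ hTd z
    calc dist z x ≤ dist z (T x) + dist x (T x) := dist_triangle_right _ _ _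
      _ ≤ 1 / n + 1 / n := add_le_add hz' (hTd x)
      _ = 2 / n := by ring
  have hquant : |∫ t, g (T t) ∂p (z, a) - ∫ t, g t ∂p (z, a)| ≤ E := by
    rw [← integral_sub (integrable_of_abs_le hgT fun t ↦ hC (T t))
      (integrable_of_abs_le hgmeas hC)]
    exact abs_integral_le_of_abs_le (.of_forall hE)
  have hlip : |∫ t, g t ∂p (z, a) - ∫ t, g t ∂p (x, a)| ≤ 2 * K₂ / n * C :=
    calc _ ≤ C * tvDist (p (z, a)) (p (x, a)) :=
          abs_integral_sub_integral_le_mul_tvDist _ _ hgmeas hC₀ hC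
      _ ≤ C * (K₂ * (2 / n)) := by
          gcongr
          exact (hpLip a z x).trans (by gcongr)
      _ = 2 * K₂ / n * C := by ring
  rw [hκint]
  exact (abs_sub_le _ (∫ t, g t ∂p (z, a)) _).trans (by linarith)
end
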